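/- arXiv:math/9404230 — 4 statements merged into one kernel-verified Lean document; each statement's English description precedes it below -/
import Mathlib

section
/- (Hadwiger; Giertz.) Let K₁ and K₂ be centered convex bodies of revolution in ℝ³ about the same axis u₀ ∈ S², and suppose λ₂(K₁ ∩ u^⊥) ≤ λ₂(K₂ ∩ u^⊥) for all u ∈ S². Then λ₃(K₁) ≤ λ₃(K₂). -/
open MeasureTheory Metric
open scoped RealInnerProductSpace ENNReal

noncomputable section

abbrev E (n : ℕ) := EuclideanSpace ℝ (Fin n)

/-- The radial function of a set: `ρ_K(x) = max {c ≥ 0 : c • x ∈ K}`. -/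
def radialFn {n : ℕ} (K : Set (E n)) (x : E n) : ℝ :=
  sSup {c : ℝ | 0 ≤ c ∧ c • x ∈ K}

/-- A convex body: compact convex set with nonempty interior. -/
def IsConvexBody {n : ℕ} (K : Set (E n)) : Prop :=
  IsCompact K ∧ Convex ℝ K ∧ (interior K).Nonempty

/-- Centered: symmetric about the origin. -/
def IsCentered {n : ℕ} (K : Set (E n)) : Prop :=
  ∀ x, x ∈ K ↔ -x ∈ K

/-- The hyperplane through the origin orthogonal to `u`. -/
def hyperplane {n : ℕ} (u : E n) : Set (E n) := {x | ⟪x, u⟫ = 0}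

/-- A star body: compact, star-shaped at the origin (contains the origin), with
continuous radial function on the unit sphere. -/
def IsStarBody {n : ℕ} (L : Set (E n)) : Prop :=
  IsCompact L ∧ (0 : E n) ∈ L ∧ StarConvex ℝ 0 L ∧
    ContinuousOn (radialFn L) (sphere (0 : E n) 1)

/-- `L` is the intersection body of `M`: `ρ_L(u) = λ_{n-1}(M ∩ u^⊥)` for `u ∈ S^{n-1}`. -/
def IsIntersectionBodyOf {n : ℕ} (L M : Set (E n)) : Prop :=
  ∀ u ∈ sphere (0 : E n) 1,
    radialFn L u = (μH[(n : ℝ) - 1] (M ∩ hyperplane u)).toReal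

/-- The spherical Radon transform:
`(Rg)(u) = ∫_{S^{n-1} ∩ u^⊥} g dλ_{n-2}`. -/
def radon (n : ℕ) (g : E n → ℝ) (u : E n) : ℝ :=
  ∫ v in (sphere (0 : E n) 1 ∩ hyperplane u), g v ∂μH[(n : ℝ) - 2]

/-- A function on the sphere is C^∞ if its 0-homogeneous extension is smooth
away from the origin. -/
def SmoothOnSphere {n : ℕ} (h : E n → ℝ) : Prop :=
  ContDiffOn ℝ (⊤ : ℕ∞) (fun x : E n => h (‖x‖⁻¹ • x)) {(0 : E n)}ᶜ

/-- A body of revolution about the axis `u₀`: invariant under every (linear)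
isometry of `ℝⁿ` fixing `u₀`. -/
def IsRevolutionBody {n : ℕ} (u₀ : E n) (K : Set (E n)) : Prop :=
  ∀ f : E n ≃ₗᵢ[ℝ] E n, f u₀ = u₀ → f '' K = K

/-! ### One-dimensional integrals -/

theorem lintegral_eq_abs_mul_lintegral_comp_mul_left (f : ℝ → ℝ≥0∞) {a : ℝ} (ha : a ≠ 0) :
    ∫⁻ x, f x = ENNReal.ofReal |a| * ∫⁻ x, f (a * x) := by
  have h := lintegral_map_equiv (μ := volume) f (Homeomorph.mulLeft₀ a ha).toMeasurableEquiv
  have h' : Measure.map (Homeomorph.mulLeft₀ a ha).toMeasurableEquiv (volume : Measure ℝ)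
      = ENNReal.ofReal |a⁻¹| • volume := Real.map_volume_mul_left ha
  rw [h', lintegral_smul_measure, smul_eq_mul] at h
  change _ = ∫⁻ x, f (a * x) at h
  rw [← h, ← mul_assoc, ← ENNReal.ofReal_mul (abs_nonneg a), ← abs_mul, mul_inv_cancel₀ ha]
  simp

theorem lintegral_inv_one_add_sq :
    ∫⁻ v : ℝ, ENNReal.ofReal (1 + v ^ 2)⁻¹ = ENNReal.ofReal Real.pi := by
  rw [← ofReal_integral_eq_lintegral_ofReal integrable_inv_one_add_sq
    (Filter.Eventually.of_forall fun v => by positivity), integral_univ_inv_one_add_sq]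

theorem lintegral_inv_sqrt_one_sub_sq :
    ∫⁻ t : ℝ, ENNReal.ofReal (√(1 - t ^ 2))⁻¹ = ENNReal.ofReal Real.pi := by
  have hint : IntervalIntegrable (fun t : ℝ => (√(1 - t ^ 2))⁻¹) volume (-1) 1 := by
    simpa only [Real.sqrt_inv] using
      Polynomial.Chebyshev.intervalIntegrable_sqrt_one_sub_sq_inv
  have hval : ∫ t in (-1 : ℝ)..1, (√(1 - t ^ 2))⁻¹ = Real.pi := by
    have hint' : IntervalIntegrable (fun t : ℝ => 1 / √(1 - t ^ 2)) volume (-1) 1 := by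
      simpa using hint
    have := intervalIntegral.integral_eq_sub_of_hasDerivAt_of_le (by norm_num : (-1 : ℝ) ≤ 1)
      Real.continuous_arcsin.continuousOn
      (fun x hx => Real.hasDerivAt_arcsin (ne_of_gt hx.1) (ne_of_lt hx.2)) hint'
    simp only [one_div, Real.arcsin_one, Real.arcsin_neg_one] at this
    rw [this]; ring
  rw [intervalIntegrable_iff, Set.uIoc_of_le (by norm_num)] at hint
  have hsupp : ∫⁻ t : ℝ, ENNReal.ofReal (√(1 - t ^ 2))⁻¹
      = ∫⁻ t in Set.Ioc (-1 : ℝ) 1, ENNReal.ofReal (√(1 - t ^ 2))⁻¹ := by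
    rw [← lintegral_indicator measurableSet_Ioc]
    refine lintegral_congr fun t => ?_
    by_cases ht : t ∈ Set.Ioc (-1 : ℝ) 1
    · rw [Set.indicator_of_mem ht]
    · rw [Set.indicator_of_notMem ht, Real.sqrt_eq_zero_of_nonpos]
      · simp
      · by_contra! h
        exact ht ⟨by nlinarith, by nlinarith⟩
  rw [hsupp, ← ofReal_integral_eq_lintegral_ofReal hint
    (Filter.Eventually.of_forall fun v => by positivity),
    ← intervalIntegral.integral_of_le (by norm_num), hval]

/-- The density on slopes whose average over the planes `z = α x` is constant on `|z| < β r`. -/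
def slopeWeight (β α : ℝ) : ℝ := |α| / √(β ^ 2 - α ^ 2)

theorem slopeWeight_nonneg (β α : ℝ) : 0 ≤ slopeWeight β α := by
  unfold slopeWeight; positivity

theorem measurable_slopeWeight (β : ℝ) : Measurable (slopeWeight β) := by
  unfold slopeWeight; fun_prop

theorem lintegral_slopeWeight_of_lt {β q : ℝ} (hq : q ≠ 0) (hqβ : |q| < β) :
    ∫⁻ v : ℝ, ENNReal.ofReal ((√(1 + v ^ 2))⁻¹ * slopeWeight β (√(1 + v ^ 2) * q))
      = ENNReal.ofReal Real.pi := by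
  have hd : 0 < β ^ 2 - q ^ 2 := by
    have := sq_lt_sq' (by linarith [abs_nonneg q]) hqβ
    rw [sq_abs] at this; linarith
  have hq' : 0 < |q| := abs_pos.2 hq
  have ha : 0 < √(β ^ 2 - q ^ 2) / |q| := div_pos (Real.sqrt_pos.2 hd) hq'
  set a := √(β ^ 2 - q ^ 2) / |q| with ha_def
  rw [lintegral_eq_abs_mul_lintegral_comp_mul_left _ ha.ne', ← lintegral_const_mul' _ _ (by simp),
    ← lintegral_inv_sqrt_one_sub_sq]
  refine lintegral_congr fun t => ?_
  rw [← ENNReal.ofReal_mul (abs_nonneg a), abs_of_pos ha]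
  congr 1
  have hs : 0 < √(1 + (a * t) ^ 2) := Real.sqrt_pos.2 (by positivity)
  have haq : a * |q| = √(β ^ 2 - q ^ 2) := by rw [ha_def]; field_simp
  have hq2 : a ^ 2 * q ^ 2 = β ^ 2 - q ^ 2 := by
    rw [← sq_abs q, ← mul_pow, haq, Real.sq_sqrt hd.le, sq_abs]
  have hrad : β ^ 2 - (√(1 + (a * t) ^ 2) * q) ^ 2 = (β ^ 2 - q ^ 2) * (1 - t ^ 2) := by
    rw [mul_pow, Real.sq_sqrt (by positivity)]
    linear_combination (-t ^ 2) * hq2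
  unfold slopeWeight
  rw [hrad, Real.sqrt_mul hd.le, abs_mul, abs_of_pos hs, ← haq]
  by_cases ht : √(1 - t ^ 2) = 0
  · simp [ht]
  · field_simp

theorem lintegral_slopeWeight_of_le {β q : ℝ} (hβ : 0 ≤ β) (hqβ : β ≤ |q|) :
    ∫⁻ v : ℝ, ENNReal.ofReal ((√(1 + v ^ 2))⁻¹ * slopeWeight β (√(1 + v ^ 2) * q)) = 0 := by
  have h : ∀ v : ℝ, slopeWeight β (√(1 + v ^ 2) * q) = 0 := by
    intro v
    have hrad : β ^ 2 - (√(1 + v ^ 2) * q) ^ 2 ≤ 0 := by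
      rw [mul_pow, Real.sq_sqrt (by positivity)]
      have := sq_le_sq' (by linarith) hqβ
      rw [sq_abs] at this
      nlinarith [sq_nonneg (v * q)]
    rw [slopeWeight, Real.sqrt_eq_zero_of_nonpos hrad, div_zero]
  simp [h]

/-! ### Integration in slope coordinates -/

theorem lintegral_lintegral_slope_polar {H : ℝ → ℝ → ℝ≥0∞}
    (hH : Measurable (Function.uncurry H)) :
    ∫⁻ x, ∫⁻ y, H x y = ∫⁻ v : ℝ, ∫⁻ x : ℝ, ENNReal.ofReal (|x| * (1 + v ^ 2)⁻¹) *
      H ((√(1 + v ^ 2))⁻¹ * x) ((√(1 + v ^ 2))⁻¹ * x * v) := by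
  have hne : ∀ᵐ x : ℝ, x ≠ 0 := by simp [ae_iff]
  calc ∫⁻ x, ∫⁻ y, H x y
      = ∫⁻ x : ℝ, ∫⁻ v : ℝ, ENNReal.ofReal |x| * H x (x * v) := by
        refine lintegral_congr_ae ?_
        filter_upwards [hne] with x hx
        rw [lintegral_eq_abs_mul_lintegral_comp_mul_left _ hx, lintegral_const_mul' _ _ (by simp)]
    _ = ∫⁻ v : ℝ, ∫⁻ x : ℝ, ENNReal.ofReal |x| * H x (x * v) := by
        refine lintegral_lintegral_swap (Measurable.aemeasurable ?_)
        have : Measurable fun p : ℝ × ℝ => Function.uncurry H (p.1, p.1 * p.2) :=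
          hH.comp (by fun_prop)
        simp only [Function.uncurry] at this ⊢
        fun_prop
    _ = _ := by
        refine lintegral_congr fun v => ?_
        have hs : 0 < (√(1 + v ^ 2))⁻¹ := inv_pos.2 (Real.sqrt_pos.2 (by positivity))
        rw [lintegral_eq_abs_mul_lintegral_comp_mul_left _ hs.ne',
          ← lintegral_const_mul' _ _ (by simp)]
        refine lintegral_congr fun x => ?_
        rw [← mul_assoc, ← ENNReal.ofReal_mul (abs_nonneg _), abs_mul, abs_of_pos hs]
        congr 2
        have : (√(1 + v ^ 2))⁻¹ * (√(1 + v ^ 2))⁻¹ = (1 + v ^ 2)⁻¹ := by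
          rw [← mul_inv, Real.mul_self_sqrt (by positivity)]
        rw [← this]; ring

theorem sqrt_sq_add_sq_slope (x v : ℝ) :
    √(((√(1 + v ^ 2))⁻¹ * x) ^ 2 + ((√(1 + v ^ 2))⁻¹ * x * v) ^ 2) = |x| := by
  have h : ((√(1 + v ^ 2))⁻¹ * x) ^ 2 + ((√(1 + v ^ 2))⁻¹ * x * v) ^ 2 = x ^ 2 := by
    have : 0 < 1 + v ^ 2 := by positivity
    rw [mul_pow, mul_pow, mul_pow, inv_pow, Real.sq_sqrt this.le]
    field_simp
  rw [h, Real.sqrt_sq_eq_abs]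

theorem lintegral_lintegral_radial {f : ℝ → ℝ≥0∞} (hf : Measurable f) (heven : ∀ x, f |x| = f x) :
    ∫⁻ x : ℝ, ∫⁻ y : ℝ, f √(x ^ 2 + y ^ 2)
      = ENNReal.ofReal Real.pi * ∫⁻ x : ℝ, ENNReal.ofReal |x| * f x := by
  rw [lintegral_lintegral_slope_polar (H := fun x y => f √(x ^ 2 + y ^ 2))
    (hf.comp (by fun_prop)), ← lintegral_inv_one_add_sq, ← lintegral_mul_const _ (by fun_prop)]
  refine lintegral_congr fun v => ?_
  rw [← lintegral_const_mul' _ _ (by simp)]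
  refine lintegral_congr fun x => ?_
  rw [sqrt_sq_add_sq_slope, heven, mul_comm |x|, ENNReal.ofReal_mul (by positivity), mul_assoc]

theorem lintegral_slopeWeight_mul_section {F : ℝ → ℝ → ℝ≥0∞}
    (hF : Measurable (Function.uncurry F)) (heven : ∀ x z, F |x| z = F x z) {β : ℝ} (hβ : 0 ≤ β) :
    ∫⁻ α : ℝ, ENNReal.ofReal (slopeWeight β α) * ∫⁻ x : ℝ, ∫⁻ y : ℝ, F √(x ^ 2 + y ^ 2) (α * x)
      = ENNReal.ofReal Real.pi * ∫⁻ x : ℝ, ∫⁻ z : ℝ, if |z / x| ≤ β then F x z else 0 := by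
  have hne : ∀ᵐ x : ℝ, x ≠ 0 := by simp [ae_iff]
  have hw := measurable_slopeWeight β
  have hsec : ∀ α : ℝ, ENNReal.ofReal (slopeWeight β α) *
      ∫⁻ x : ℝ, ∫⁻ y : ℝ, F √(x ^ 2 + y ^ 2) (α * x)
      = ∫⁻ v : ℝ, ∫⁻ x : ℝ, ENNReal.ofReal (slopeWeight β α) *
        (ENNReal.ofReal (|x| * (1 + v ^ 2)⁻¹) * F x (α * ((√(1 + v ^ 2))⁻¹ * x))) := by
    intro α
    rw [lintegral_lintegral_slope_polar (H := fun x y => F √(x ^ 2 + y ^ 2) (α * x))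
      (hF.comp (f := fun p : ℝ × ℝ => (√(p.1 ^ 2 + p.2 ^ 2), α * p.1)) (by fun_prop)),
      ← lintegral_const_mul' _ _ (by simp)]
    refine lintegral_congr fun v => ?_
    rw [← lintegral_const_mul' _ _ (by simp)]
    refine lintegral_congr fun x => ?_
    rw [sqrt_sq_add_sq_slope, heven]
  have hmeas : Measurable fun p : (ℝ × ℝ) × ℝ => ENNReal.ofReal (slopeWeight β p.1.1) *
      (ENNReal.ofReal (|p.2| * (1 + p.1.2 ^ 2)⁻¹) *
        F p.2 (p.1.1 * ((√(1 + p.1.2 ^ 2))⁻¹ * p.2))) := by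
    have : Measurable fun p : (ℝ × ℝ) × ℝ => F p.2 (p.1.1 * ((√(1 + p.1.2 ^ 2))⁻¹ * p.2)) :=
      hF.comp (f := fun p : (ℝ × ℝ) × ℝ => (p.2, p.1.1 * ((√(1 + p.1.2 ^ 2))⁻¹ * p.2)))
        (by fun_prop)
    fun_prop
  have hmeas₂ : Measurable fun p : (ℝ × ℝ) × ℝ => ENNReal.ofReal ((√(1 + p.1.2 ^ 2))⁻¹ *
      slopeWeight β (√(1 + p.1.2 ^ 2) * (p.2 / p.1.1))) * F p.1.1 p.2 := by
    have : Measurable fun p : (ℝ × ℝ) × ℝ => F p.1.1 p.2 :=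
      hF.comp (f := fun p : (ℝ × ℝ) × ℝ => (p.1.1, p.2)) (by fun_prop)
    fun_prop
  simp_rw [hsec]
  rw [lintegral_lintegral_swap (Measurable.aemeasurable hmeas.lintegral_prod_right')]
  calc _ = ∫⁻ v : ℝ, ∫⁻ x : ℝ, ∫⁻ z : ℝ, ENNReal.ofReal ((√(1 + v ^ 2))⁻¹ *
        slopeWeight β (√(1 + v ^ 2) * (z / x))) * F x z := by
        refine lintegral_congr fun v => ?_
        have hm : Measurable (Function.uncurry fun α x : ℝ => ENNReal.ofReal (slopeWeight β α) *
            (ENNReal.ofReal (|x| * (1 + v ^ 2)⁻¹) * F x (α * ((√(1 + v ^ 2))⁻¹ * x)))) :=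
          hmeas.comp (f := fun p : ℝ × ℝ => ((p.1, v), p.2)) (by fun_prop)
        rw [lintegral_lintegral_swap hm.aemeasurable]
        refine lintegral_congr_ae ?_
        filter_upwards [hne] with x hx
        have hs : 0 < √(1 + v ^ 2) := Real.sqrt_pos.2 (by positivity)
        rw [lintegral_eq_abs_mul_lintegral_comp_mul_left _ (div_ne_zero hs.ne' hx),
          ← lintegral_const_mul' _ _ (by simp)]
        refine lintegral_congr fun z => ?_
        have hz : √(1 + v ^ 2) / x * z * ((√(1 + v ^ 2))⁻¹ * x) = z := by field_simp
        rw [hz, ← mul_assoc, ← mul_assoc, ← ENNReal.ofReal_mul (abs_nonneg _),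
          ← ENNReal.ofReal_mul (by have := slopeWeight_nonneg β (√(1 + v ^ 2) / x * z); positivity)]
        congr 2
        rw [abs_div, abs_of_pos hs, div_mul_eq_mul_div, mul_div_assoc]
        have hx' : |x| ≠ 0 := abs_ne_zero.2 hx
        have h1 : (1 + v ^ 2)⁻¹ = (√(1 + v ^ 2))⁻¹ * (√(1 + v ^ 2))⁻¹ := by
          rw [← mul_inv, Real.mul_self_sqrt (by positivity)]
        rw [h1]
        field_simp
    _ = ∫⁻ x : ℝ, ∫⁻ v : ℝ, ∫⁻ z : ℝ, ENNReal.ofReal ((√(1 + v ^ 2))⁻¹ *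
        slopeWeight β (√(1 + v ^ 2) * (z / x))) * F x z :=
        (lintegral_lintegral_swap (Measurable.aemeasurable hmeas₂.lintegral_prod_right')).symm
    _ = ∫⁻ x : ℝ, ENNReal.ofReal Real.pi * ∫⁻ z : ℝ, if |z / x| ≤ β then F x z else 0 := by
        refine lintegral_congr_ae ?_
        filter_upwards [hne] with x hx
        have hm : Measurable (Function.uncurry fun v z : ℝ => ENNReal.ofReal ((√(1 + v ^ 2))⁻¹ *
            slopeWeight β (√(1 + v ^ 2) * (z / x))) * F x z) :=
          hmeas₂.comp (f := fun p : ℝ × ℝ => ((x, p.1), p.2)) (by fun_prop)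
        rw [lintegral_lintegral_swap hm.aemeasurable,
          ← lintegral_const_mul' _ _ (by simp)]
        have hz : ∀ᵐ z : ℝ, z ∉ ({0, β * x, -β * x} : Set ℝ) :=
          measure_eq_zero_iff_ae_notMem.1 ((Set.toFinite _).measure_zero _)
        refine lintegral_congr_ae ?_
        filter_upwards [hz] with z hz
        simp only [Set.mem_insert_iff, Set.mem_singleton_iff, not_or] at hz
        obtain ⟨hz0, hz1, hz2⟩ := hz
        rw [lintegral_mul_const _ (by fun_prop)]
        have hqβ : |z / x| ≠ β := by
          intro h
          rcases eq_or_eq_neg_of_abs_eq h with h | h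
          · exact hz1 (by rw [← h]; field_simp)
          · exact hz2 (by rw [← h]; field_simp)
        rcases lt_or_gt_of_ne hqβ with h | h
        · rw [lintegral_slopeWeight_of_lt (div_ne_zero hz0 hx) h, if_pos h.le]
        · rw [lintegral_slopeWeight_of_le hβ h.le, if_neg (not_le.2 h), zero_mul, mul_zero]
    _ = _ := lintegral_const_mul' _ _ (by simp)

/-! ### Comparison of meridian sections -/

theorem exists_preimage_slope_eq {D : Set (ℝ × ℝ)} (hD : IsCompact D) (hconv : Convex ℝ D)
    (hneg : ∀ r z, (r, z) ∈ D → (r, -z) ∈ D) {l : ℝ} (hl : 0 < l)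
    (hne : {q : ℝ | (l, l * q) ∈ D}.Nonempty) :
    ∃ β, 0 ≤ β ∧ {q : ℝ | (l, l * q) ∈ D} = {q | |q| ≤ β} := by
  set C := {q : ℝ | (l, l * q) ∈ D} with hC
  have hclosed : IsClosed C := hD.isClosed.preimage (by fun_prop : Continuous fun q => (l, l * q))
  have hcpt : IsCompact C := by
    refine (hD.image (by fun_prop : Continuous fun p : ℝ × ℝ => p.2 / l)).of_isClosed_subset
      hclosed fun q hq => ⟨(l, l * q), hq, ?_⟩
    simp [hl.ne']
  have hconvC : Convex ℝ C := by
    intro q hq q' hq' a b ha hb hab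
    have := hconv hq hq' ha hb hab
    simp only [hC, Set.mem_ofPred_eq]
    convert! this using 1
    ext
    · simp [← add_mul, hab]
    · simp only [smul_eq_mul, Prod.snd_add, Prod.smul_snd]; ring
  have hnegC : ∀ q ∈ C, -q ∈ C := fun q hq => by
    have := hneg _ _ hq
    simpa [hC] using this
  obtain ⟨q₀, hq₀, hmax⟩ := hcpt.exists_isMaxOn hne continuous_abs.continuousOn
  refine ⟨|q₀|, abs_nonneg _, Set.Subset.antisymm (fun q hq => hmax hq) fun q hq => ?_⟩
  have hmem : |q₀| ∈ C := by
    rcases abs_choice q₀ with h | h <;> rw [h]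
    exacts [hq₀, hnegC _ hq₀]
  exact hconvC.ordConnected.out (hnegC _ hmem) hmem (abs_le.1 hq)

/-- For a convex body of revolution, the distance from the axis of its boundary point in a given
direction is a decreasing function of the slope; comparing areas of the meridian sections within
all cones around the equator therefore compares volumes. -/
theorem setLIntegral_abs_fst_le_of_measure_cone_le {D₁ D₂ : Set (ℝ × ℝ)} (hD₁ : IsCompact D₁)
    (hconv : Convex ℝ D₁) (h0 : (0 : ℝ × ℝ) ∈ D₁)
    (hfst : ∀ r z, (r, z) ∈ D₁ → (-r, z) ∈ D₁) (hsnd : ∀ r z, (r, z) ∈ D₁ → (r, -z) ∈ D₁)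
    (hD₂ : MeasurableSet D₂)
    (hcone : ∀ β, 0 ≤ β → volume (D₁ ∩ {p : ℝ × ℝ | |p.2 / p.1| ≤ β})
      ≤ volume (D₂ ∩ {p : ℝ × ℝ | |p.2 / p.1| ≤ β})) :
    ∫⁻ p in D₁, ENNReal.ofReal |p.1| ≤ ∫⁻ p in D₂, ENNReal.ofReal |p.1| := by
  have hmD₁ := hD₁.isClosed.measurableSet
  set S : Set ((ℝ × ℝ) × ℝ) := {t | 0 < t.2 ∧ (t.2, t.2 * (t.1.2 / t.1.1)) ∈ D₁} with hS
  have hmS : MeasurableSet S :=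
    (measurableSet_lt measurable_const measurable_snd).inter
      (measurableSet_preimage
        (by fun_prop : Measurable fun t : (ℝ × ℝ) × ℝ => (t.2, t.2 * (t.1.2 / t.1.1))) hmD₁)
  set N : ℝ × ℝ → ℝ≥0∞ := fun p => volume (Prod.mk p ⁻¹' S) with hN
  have hmN : Measurable N := measurable_measure_prodMk_left hmS
  have hray : ∀ {p : ℝ × ℝ}, p.1 ≠ 0 → (p ∈ D₁ ↔ (|p.1|, |p.1| * (p.2 / p.1)) ∈ D₁) := by
    rintro ⟨r, z⟩ hr
    simp only at hr ⊢
    rcases lt_or_gt_of_ne hr with h | h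
    · have : -r * (z / r) = -z := by field_simp
      rw [abs_of_neg h, this]
      refine ⟨fun hp => hfst _ _ (hsnd _ _ hp), fun hp => ?_⟩
      simpa using hfst _ _ (hsnd _ _ hp)
    · have : r * (z / r) = z := by field_simp
      rw [abs_of_pos h, this]
  have hscale : ∀ {a b q : ℝ}, 0 < a → a ≤ b → (b, b * q) ∈ D₁ → (a, a * q) ∈ D₁ := by
    intro a b q ha hab hb
    have hb0 : 0 < b := ha.trans_le hab
    have := hconv.smul_mem_of_zero_mem h0 hb
      (t := a / b) ⟨by positivity, (div_le_one hb0).2 hab⟩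
    convert! this using 1
    ext <;> simp <;> field_simp
  have hN_ge : ∀ p ∈ D₁, ENNReal.ofReal |p.1| ≤ N p := by
    intro p hp
    by_cases hr : p.1 = 0
    · simp [hr]
    · calc ENNReal.ofReal |p.1| = volume (Set.Ioc 0 |p.1|) := by simp
        _ ≤ N p := measure_mono fun l hl => ⟨hl.1, hscale hl.1 hl.2 ((hray hr).1 hp)⟩
  have hN_le : ∀ p, p ∉ D₁ → p.1 ≠ 0 → N p ≤ ENNReal.ofReal |p.1| := by
    intro p hp hr
    calc N p ≤ volume (Set.Ioc 0 |p.1|) := measure_mono fun l hl => ⟨hl.1, by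
            by_contra! h
            exact hp ((hray hr).2 (hscale (abs_pos.2 hr) h.le hl.2))⟩
      _ = ENNReal.ofReal |p.1| := by simp
  obtain ⟨R, hR⟩ := hD₁.isBounded.exists_norm_le
  have hN_bdd : ∀ p, N p ≤ ENNReal.ofReal R := by
    intro p
    calc N p ≤ volume (Set.Ioc 0 R) := measure_mono fun l hl => ⟨hl.1, by
            have := (norm_fst_le _).trans (hR _ hl.2)
            exact (le_abs_self l).trans this⟩
      _ = ENNReal.ofReal R := by simp
  have hint : ∫⁻ p in D₁, N p ≤ ∫⁻ p in D₂, N p := by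
    simp only [hN]
    rw [← Measure.prod_apply hmS, ← Measure.prod_apply hmS, Measure.prod_apply_symm hmS,
      Measure.prod_apply_symm hmS]
    refine lintegral_mono fun l => ?_
    by_cases hl : 0 < l
    · have hpre : (fun p : ℝ × ℝ => (p, l)) ⁻¹' S
          = (fun p : ℝ × ℝ => p.2 / p.1) ⁻¹' {q | (l, l * q) ∈ D₁} := by
        ext p; simp [hS, hl]
      rcases Set.eq_empty_or_nonempty {q : ℝ | (l, l * q) ∈ D₁} with he | hne
      · simp [hpre, he]
      · obtain ⟨β, hβ, h⟩ := exists_preimage_slope_eq hD₁ hconv hsnd hl hne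
        have hmc : MeasurableSet ((fun p : ℝ × ℝ => p.2 / p.1) ⁻¹' {q | |q| ≤ β}) :=
          measurableSet_preimage (by fun_prop) (measurableSet_le (by fun_prop) (by fun_prop))
        simp only [hpre, h]
        rw [Measure.restrict_apply hmc, Measure.restrict_apply hmc, Set.inter_comm _ D₁,
          Set.inter_comm _ D₂]
        exact hcone β hβ
    · have hpre : (fun p : ℝ × ℝ => (p, l)) ⁻¹' S = ∅ := by
        ext p; simp [hS, hl]
      simp [hpre]
  have hfin : ∫⁻ p in D₁ ∩ D₂, N p ≠ ⊤ := by
    refine ne_of_lt ((setLIntegral_mono measurable_const fun p _ => hN_bdd p).trans_lt ?_)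
    rw [setLIntegral_const]
    exact ENNReal.mul_lt_top ENNReal.ofReal_lt_top
      ((measure_mono Set.inter_subset_left).trans_lt hD₁.measure_lt_top)
  have hdiff : ∫⁻ p in D₁ \ D₂, N p ≤ ∫⁻ p in D₂ \ D₁, N p := by
    rw [← lintegral_inter_add_sdiff N D₁ hD₂, ← lintegral_inter_add_sdiff N D₂ hmD₁,
      Set.inter_comm D₂ D₁] at hint
    exact (ENNReal.add_le_add_iff_left hfin).1 hint
  have hne : ∀ᵐ p : ℝ × ℝ, p.1 ≠ 0 := by
    have : ∀ᵐ x : ℝ, x ≠ 0 := by simp [ae_iff]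
    exact Measure.quasiMeasurePreserving_fst.ae this
  rw [← lintegral_inter_add_sdiff _ D₁ hD₂, ← lintegral_inter_add_sdiff _ D₂ hmD₁,
    Set.inter_comm D₂ D₁]
  refine add_le_add_right ?_ _
  calc ∫⁻ p in D₁ \ D₂, ENNReal.ofReal |p.1|
      ≤ ∫⁻ p in D₁ \ D₂, N p := setLIntegral_mono hmN fun p hp => hN_ge p hp.1
    _ ≤ ∫⁻ p in D₂ \ D₁, N p := hdiff
    _ ≤ ∫⁻ p in D₂ \ D₁, ENNReal.ofReal |p.1| := by
        refine setLIntegral_mono_ae (by fun_prop) ?_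
        filter_upwards [hne] with p hp hpD using hN_le p hpD.2 hp

/-! ### Hausdorff measure of linear images -/

theorem exists_hausdorffMeasure_image_eq_mul {V W : Type*} [NormedAddCommGroup V]
    [NormedSpace ℝ V] [FiniteDimensional ℝ V] [MeasurableSpace V] [BorelSpace V]
    (μ : Measure V) [μ.IsAddHaarMeasure] [NormedAddCommGroup W] [NormedSpace ℝ W]
    [MeasurableSpace W] [BorelSpace W] (S : V →ₗ[ℝ] W) (hS : Function.Injective S) :
    ∃ c : ℝ≥0∞, c ≠ 0 ∧ c ≠ ⊤ ∧
      ∀ A : Set V, μH[Module.finrank ℝ V] (S '' A) = c * μ A := by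
  let e : V ≃L[ℝ] S.range := (LinearEquiv.ofInjective S hS).toContinuousLinearEquiv
  have hfin : Module.finrank ℝ S.range = Module.finrank ℝ V := LinearMap.finrank_range_of_inj hS
  have hhaar : (μH[Module.finrank ℝ V] : Measure S.range).IsAddHaarMeasure := by
    rw [← hfin]; infer_instance
  let ν : Measure V := Measure.map e.symm μH[Module.finrank ℝ V]
  have hν : ν.IsAddHaarMeasure := e.symm.isAddHaarMeasure_map _
  have hsmul := Measure.isAddLeftInvariant_eq_smul ν μ
  refine ⟨Measure.addHaarScalarFactor ν μ, ?_, ENNReal.coe_ne_top, fun A => ?_⟩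
  · simpa using (Measure.addHaarScalarFactor_pos_of_isAddHaarMeasure ν μ).ne'
  · have himg : S '' A = Subtype.val '' (e '' A) := by
      rw [Set.image_image]; rfl
    have hνA : ν A = μH[Module.finrank ℝ V] (e '' A) := by
      rw [e.image_eq_preimage_symm]
      exact e.symm.toHomeomorph.toMeasurableEquiv.map_apply A
    rw [himg, isometry_subtype_coe.hausdorffMeasure_image (Or.inl (by positivity)), ← hνA]
    exact congrArg (fun m : Measure V => m A) hsmul

/-! ### Bodies of revolution in coordinates -/

theorem exists_linearMap_coordinates {u₀ : E 3} (hu₀ : u₀ ∈ sphere (0 : E 3) 1) :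
    ∃ T : ℝ × ℝ × ℝ →ₗ[ℝ] E 3, T (0, 0, 1) = u₀ ∧
      ∀ p q, ⟪T p, T q⟫ = p.1 * q.1 + p.2.1 * q.2.1 + p.2.2 * q.2.2 := by
  have hnorm : ‖u₀‖ = 1 := by simpa using hu₀
  have hv : Orthonormal ℝ (({2} : Set (Fin 3)).domRestrict fun _ => u₀) :=
    ⟨fun _ => hnorm, fun i j hij => absurd (Subsingleton.elim i j) hij⟩
  obtain ⟨b, hb⟩ := hv.exists_orthonormalBasis_extension_of_card_eq (by simp)
  refine ⟨(LinearMap.fst ℝ ℝ (ℝ × ℝ)).smulRight (b 0) +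
    ((LinearMap.fst ℝ ℝ ℝ).comp (LinearMap.snd ℝ ℝ (ℝ × ℝ))).smulRight (b 1) +
    ((LinearMap.snd ℝ ℝ ℝ).comp (LinearMap.snd ℝ ℝ (ℝ × ℝ))).smulRight (b 2), ?_, fun p q => ?_⟩
  · simp [hb 2 rfl]
  · simp [inner_add_left, inner_add_right, real_inner_smul_left, real_inner_smul_right,
      b.inner_eq_ite]
    ring

theorem injective_of_inner_coordinates {T : ℝ × ℝ × ℝ →ₗ[ℝ] E 3}
    (hT : ∀ p q, ⟪T p, T q⟫ = p.1 * q.1 + p.2.1 * q.2.1 + p.2.2 * q.2.2) :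
    Function.Injective T := by
  refine (injective_iff_map_eq_zero T).2 fun p hp => ?_
  have h := hT p p
  rw [hp, inner_zero_left] at h
  have h1 : p.1 = 0 := by nlinarith [sq_nonneg p.1, sq_nonneg p.2.1, sq_nonneg p.2.2]
  have h2 : p.2.1 = 0 := by nlinarith [sq_nonneg p.1, sq_nonneg p.2.1, sq_nonneg p.2.2]
  have h3 : p.2.2 = 0 := by nlinarith [sq_nonneg p.1, sq_nonneg p.2.1, sq_nonneg p.2.2]
  exact Prod.ext h1 (Prod.ext h2 h3)

theorem IsRevolutionBody.mem_of_norm_eq {n : ℕ} {u₀ : E n} {K : Set (E n)}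
    (hK : IsRevolutionBody u₀ K) {v w : E n} (hnorm : ‖v‖ = ‖w‖) (hinner : ⟪v, u₀⟫ = ⟪w, u₀⟫)
    (hv : v ∈ K) : w ∈ K := by
  have hfix : (ℝ ∙ (v - w))ᗮ.reflection u₀ = u₀ := by
    rw [Submodule.reflection_eq_self_iff, Submodule.mem_orthogonal_singleton_iff_inner_right,
      inner_sub_left, hinner, sub_self]
  rw [← hK _ hfix]
  exact ⟨v, hv, Submodule.reflection_sub hnorm⟩

/-- The meridian section of a body of revolution, as a subset of the `(r, z)`-plane. -/
def meridian (T : ℝ × ℝ × ℝ →ₗ[ℝ] E 3) (K : Set (E 3)) : Set (ℝ × ℝ) :=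
  {p | T (p.1, 0, p.2) ∈ K}

section Meridian

variable {T : ℝ × ℝ × ℝ →ₗ[ℝ] E 3} {K : Set (E 3)}

theorem mem_iff_mem_meridian {u₀ : E 3} (hT₀ : T (0, 0, 1) = u₀)
    (hT : ∀ p q, ⟪T p, T q⟫ = p.1 * q.1 + p.2.1 * q.2.1 + p.2.2 * q.2.2)
    (hK : IsRevolutionBody u₀ K) (r x y z : ℝ) (hr : r ^ 2 = x ^ 2 + y ^ 2) :
    T (x, y, z) ∈ K ↔ (r, z) ∈ meridian T K := by
  have hnorm : ‖T (x, y, z)‖ = ‖T (r, 0, z)‖ := by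
    rw [← sq_eq_sq₀ (norm_nonneg _) (norm_nonneg _), ← real_inner_self_eq_norm_sq,
      ← real_inner_self_eq_norm_sq, hT, hT]
    simp only
    linarith
  have hinner : ⟪T (x, y, z), u₀⟫ = ⟪T (r, 0, z), u₀⟫ := by
    rw [← hT₀, hT, hT]; simp
  exact ⟨hK.mem_of_norm_eq hnorm hinner, hK.mem_of_norm_eq hnorm.symm hinner.symm⟩

theorem isCompact_meridian (hT : Function.Injective T) (hK : IsCompact K) :
    IsCompact (meridian T K) := by
  let S : ℝ × ℝ →ₗ[ℝ] E 3 := T.comp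
    ((LinearMap.fst ℝ ℝ ℝ).prod ((0 : ℝ × ℝ →ₗ[ℝ] ℝ).prod (LinearMap.snd ℝ ℝ ℝ)))
  have hS : Function.Injective S := fun p q h => by
    have := hT h
    simpa [Prod.ext_iff] using this
  exact (LinearMap.isClosedEmbedding_of_injective (LinearMap.ker_eq_bot.2 hS)).isCompact_preimage hK

theorem convex_meridian (hK : Convex ℝ K) : Convex ℝ (meridian T K) := by
  intro p hp q hq a b ha hb hab
  have := hK hp hq ha hb hab
  rw [← map_smul, ← map_smul, ← map_add] at this
  simpa [meridian] using this

theorem indicator_meridian_abs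
    (hmem : ∀ r x y z : ℝ, r ^ 2 = x ^ 2 + y ^ 2 → (T (x, y, z) ∈ K ↔ (r, z) ∈ meridian T K))
    (x z : ℝ) : (meridian T K).indicator (1 : ℝ × ℝ → ℝ≥0∞) (|x|, z)
      = (meridian T K).indicator 1 (x, z) := by
  have h : (|x|, z) ∈ meridian T K ↔ (x, z) ∈ meridian T K :=
    (hmem |x| x 0 z (by simp)).symm.trans (hmem x x 0 z (by simp))
  by_cases hx : (x, z) ∈ meridian T K
  · rw [Set.indicator_of_mem hx, Set.indicator_of_mem (h.2 hx)]; rfl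
  · rw [Set.indicator_of_notMem hx, Set.indicator_of_notMem (mt h.1 hx)]

theorem volume_preimage_eq_lintegral_meridian (hK : MeasurableSet (meridian T K))
    (hmem : ∀ r x y z : ℝ, r ^ 2 = x ^ 2 + y ^ 2 → (T (x, y, z) ∈ K ↔ (r, z) ∈ meridian T K)) :
    volume (T ⁻¹' K)
      = ENNReal.ofReal Real.pi * ∫⁻ p in meridian T K, ENNReal.ofReal |p.1| := by
  set F : ℝ × ℝ → ℝ≥0∞ := (meridian T K).indicator 1 with hF
  have hmF : Measurable F := measurable_one.indicator hK
  have hset : T ⁻¹' K = (fun p : ℝ × ℝ × ℝ => (√(p.1 ^ 2 + p.2.1 ^ 2), p.2.2)) ⁻¹'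
      meridian T K := by
    ext ⟨x, y, z⟩
    exact hmem _ x y z (Real.sq_sqrt (by positivity))
  have hind : ∀ p : ℝ × ℝ × ℝ, (T ⁻¹' K).indicator (1 : ℝ × ℝ × ℝ → ℝ≥0∞) p
      = F (√(p.1 ^ 2 + p.2.1 ^ 2), p.2.2) := by
    rw [hset]
    exact fun _ => rfl
  have hmK : MeasurableSet (T ⁻¹' K) := by
    rw [hset]; exact measurableSet_preimage (by fun_prop) hK
  have heven : ∀ x z : ℝ, F (|x|, z) = F (x, z) := indicator_meridian_abs hmem
  have hm3 : Measurable fun p : ℝ × ℝ × ℝ => F (√(p.1 ^ 2 + p.2.1 ^ 2), p.2.2) :=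
    hmF.comp (by fun_prop)
  rw [← lintegral_indicator_one hmK]
  simp_rw [hind]
  rw [Measure.volume_eq_prod, lintegral_prod _ hm3.aemeasurable]
  have hinner : ∀ x : ℝ, ∫⁻ q : ℝ × ℝ, F (√(x ^ 2 + q.1 ^ 2), q.2)
      = ∫⁻ y : ℝ, ∫⁻ z : ℝ, F (√(x ^ 2 + y ^ 2), z) := by
    intro x
    have hm : Measurable fun q : ℝ × ℝ => F (√(x ^ 2 + q.1 ^ 2), q.2) := hmF.comp (by fun_prop)
    rw [Measure.volume_eq_prod, lintegral_prod _ hm.aemeasurable]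
  simp only [hinner]
  rw [lintegral_lintegral_radial (f := fun r => ∫⁻ z : ℝ, F (r, z)) hmF.lintegral_prod_right'
    (fun x => by simp only [heven])]
  congr 1
  rw [← lintegral_indicator hK, Measure.volume_eq_prod,
    lintegral_prod _ (Measurable.aemeasurable (Measurable.indicator (by fun_prop) hK))]
  refine lintegral_congr fun x => ?_
  rw [← lintegral_const_mul' _ _ (by simp)]
  refine lintegral_congr fun z => ?_
  by_cases h : (x, z) ∈ meridian T K <;> simp [hF, h]

theorem lintegral_slopeWeight_mul_volume_section (hK : MeasurableSet (meridian T K))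
    (hmem : ∀ r x y z : ℝ, r ^ 2 = x ^ 2 + y ^ 2 → (T (x, y, z) ∈ K ↔ (r, z) ∈ meridian T K))
    {β : ℝ} (hβ : 0 ≤ β) :
    ∫⁻ α : ℝ, ENNReal.ofReal (slopeWeight β α) *
        volume {p : ℝ × ℝ | T (p.1, p.2, α * p.1) ∈ K}
      = ENNReal.ofReal Real.pi * volume (meridian T K ∩ {p : ℝ × ℝ | |p.2 / p.1| ≤ β}) := by
  set F : ℝ × ℝ → ℝ≥0∞ := (meridian T K).indicator 1 with hF
  have hmF : Measurable F := measurable_one.indicator hK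
  have hsec : ∀ α : ℝ, volume {p : ℝ × ℝ | T (p.1, p.2, α * p.1) ∈ K}
      = ∫⁻ x : ℝ, ∫⁻ y : ℝ, F (√(x ^ 2 + y ^ 2), α * x) := by
    intro α
    have hset : {p : ℝ × ℝ | T (p.1, p.2, α * p.1) ∈ K}
        = (fun p : ℝ × ℝ => (√(p.1 ^ 2 + p.2 ^ 2), α * p.1)) ⁻¹' meridian T K := by
      ext ⟨x, y⟩
      exact hmem _ x y _ (Real.sq_sqrt (by positivity))
    have hm : Measurable fun p : ℝ × ℝ => (√(p.1 ^ 2 + p.2 ^ 2), α * p.1) := by fun_prop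
    rw [hset, ← lintegral_indicator_one (measurableSet_preimage hm hK), Measure.volume_eq_prod,
      lintegral_prod _ (Measurable.aemeasurable
        (measurable_one.indicator (measurableSet_preimage hm hK)))]
    rfl
  have heven : ∀ x z : ℝ, F (|x|, z) = F (x, z) := indicator_meridian_abs hmem
  simp_rw [hsec]
  rw [lintegral_slopeWeight_mul_section (F := fun r z => F (r, z)) hmF heven hβ]
  have hmc : MeasurableSet (meridian T K ∩ {p : ℝ × ℝ | |p.2 / p.1| ≤ β}) :=
    hK.inter (measurableSet_le (by fun_prop) (by fun_prop))
  rw [← lintegral_indicator_one hmc, Measure.volume_eq_prod,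
    lintegral_prod _ (Measurable.aemeasurable (measurable_one.indicator hmc))]
  congr 1
  refine lintegral_congr fun x => lintegral_congr fun z => ?_
  by_cases h : (x, z) ∈ meridian T K <;> by_cases h' : |z / x| ≤ β <;> simp [hF, h, h']

end Meridian

theorem exists_hausdorffMeasure_section_eq_mul {T : ℝ × ℝ × ℝ →ₗ[ℝ] E 3}
    (hT : ∀ p q, ⟪T p, T q⟫ = p.1 * q.1 + p.2.1 * q.2.1 + p.2.2 * q.2.2) (α : ℝ) :
    ∃ u ∈ sphere (0 : E 3) 1, ∃ c : ℝ≥0∞, c ≠ 0 ∧ c ≠ ⊤ ∧ ∀ K : Set (E 3),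
      μH[2] (K ∩ hyperplane u) = c * volume {p : ℝ × ℝ | T (p.1, p.2, α * p.1) ∈ K} := by
  have hinj := injective_of_inner_coordinates hT
  let S : ℝ × ℝ →ₗ[ℝ] E 3 := T.comp ((LinearMap.fst ℝ ℝ ℝ).prod
    ((LinearMap.snd ℝ ℝ ℝ).prod (α • LinearMap.fst ℝ ℝ ℝ)))
  have hS : Function.Injective S := fun p q h => by
    have := hinj h
    simp only [LinearMap.prod_apply, Function.prod_apply, LinearMap.fst_apply,
      LinearMap.snd_apply, Prod.mk.injEq] at this
    exact Prod.ext this.1 this.2.1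
  have hsurj : Function.Surjective T :=
    (LinearMap.injective_iff_surjective_of_finrank_eq_finrank (by simp)).1 hinj
  obtain ⟨c, hc0, hct, hc⟩ := exists_hausdorffMeasure_image_eq_mul volume S hS
  have hn : ‖T (-α, 0, 1)‖ ≠ 0 := by
    rw [norm_ne_zero_iff, Ne, map_eq_zero_iff T hinj]
    simp
  refine ⟨‖T (-α, 0, 1)‖⁻¹ • T (-α, 0, 1), ?_, c, hc0, hct, fun K => ?_⟩
  · rw [mem_sphere_zero_iff_norm, norm_smul, norm_inv, norm_norm, inv_mul_cancel₀ hn]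
  · have hset : K ∩ hyperplane (‖T (-α, 0, 1)‖⁻¹ • T (-α, 0, 1))
        = S '' {p : ℝ × ℝ | T (p.1, p.2, α * p.1) ∈ K} := by
      ext v
      obtain ⟨⟨x, y, z⟩, rfl⟩ := hsurj v
      have hmem : T (x, y, z) ∈ hyperplane (‖T (-α, 0, 1)‖⁻¹ • T (-α, 0, 1)) ↔ z = α * x := by
        simp only [hyperplane, Set.mem_ofPred_eq, real_inner_smul_right, hT, mul_eq_zero,
          inv_eq_zero, hn, false_or]
        constructor <;> intro h <;> linarith
      rw [Set.mem_inter_iff, hmem]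
      constructor
      · rintro ⟨hK, rfl⟩
        exact ⟨(x, y), hK, rfl⟩
      · rintro ⟨⟨x', y'⟩, hK, h⟩
        have := hinj h
        simp only [LinearMap.prod_apply, Function.prod_apply, LinearMap.fst_apply,
          LinearMap.snd_apply, LinearMap.smul_apply, smul_eq_mul, Prod.mk.injEq] at this
        obtain ⟨rfl, rfl, rfl⟩ := this
        exact ⟨hK, rfl⟩
    rw [hset, ← hc]
    norm_num

/-- (Hadwiger; Giertz.) The Busemann–Petty problem has a positive answer in `ℝ³`
for coaxial centered convex bodies of revolution. -/
theorem busemann_petty_coaxial_revolution (u₀ : E 3)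
    (hu₀ : u₀ ∈ sphere (0 : E 3) 1) (K₁ K₂ : Set (E 3))
    (hK₁ : IsConvexBody K₁) (hc₁ : IsCentered K₁) (hrev₁ : IsRevolutionBody u₀ K₁)
    (hK₂ : IsConvexBody K₂) (hc₂ : IsCentered K₂) (hrev₂ : IsRevolutionBody u₀ K₂)
    (hsec : ∀ u ∈ sphere (0 : E 3) 1,
      μH[2] (K₁ ∩ hyperplane u) ≤ μH[2] (K₂ ∩ hyperplane u)) :
    μH[3] K₁ ≤ μH[3] K₂ := by
  obtain ⟨T, hT₀, hT⟩ := exists_linearMap_coordinates hu₀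
  have hinj := injective_of_inner_coordinates hT
  have hsurj : Function.Surjective T :=
    (LinearMap.injective_iff_surjective_of_finrank_eq_finrank (by simp)).1 hinj
  have hmem₁ := mem_iff_mem_meridian hT₀ hT hrev₁
  have hmem₂ := mem_iff_mem_meridian hT₀ hT hrev₂
  have hD₁ := isCompact_meridian hinj hK₁.1
  have hm₁ := hD₁.isClosed.measurableSet
  have hm₂ := (isCompact_meridian hinj hK₂.1).isClosed.measurableSet
  have hconv := convex_meridian (T := T) hK₁.2.1
  have hneg : ∀ p ∈ meridian T K₁, -p ∈ meridian T K₁ := fun p hp => by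
    have := (hc₁ _).1 hp
    rw [← map_neg] at this
    simpa [meridian] using this
  have hfst : ∀ r z, (r, z) ∈ meridian T K₁ → (-r, z) ∈ meridian T K₁ := fun r z h =>
    (hmem₁ (-r) r 0 z (by simp)).1 ((hmem₁ r r 0 z (by simp)).2 h)
  have hsnd : ∀ r z, (r, z) ∈ meridian T K₁ → (r, -z) ∈ meridian T K₁ := fun r z h => by
    simpa using hfst _ _ (hneg _ h)
  have h0 : (0 : ℝ × ℝ) ∈ meridian T K₁ := by
    obtain ⟨v, hv⟩ := hK₁.2.2
    have hv := interior_subset hv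
    have := hK₁.2.1 hv ((hc₁ v).1 hv) (by norm_num : (0 : ℝ) ≤ 1 / 2)
      (by norm_num : (0 : ℝ) ≤ 1 / 2) (by norm_num)
    have h : T (0, 0, 0) = 0 := map_zero T
    simpa [meridian, h] using this
  have hcone : ∀ β, 0 ≤ β → volume (meridian T K₁ ∩ {p : ℝ × ℝ | |p.2 / p.1| ≤ β})
      ≤ volume (meridian T K₂ ∩ {p : ℝ × ℝ | |p.2 / p.1| ≤ β}) := by
    intro β hβ
    refine (ENNReal.mul_le_mul_iff_right (a := ENNReal.ofReal Real.pi)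
      (by simp [Real.pi_pos]) (by simp)).1 ?_
    rw [← lintegral_slopeWeight_mul_volume_section hm₁ hmem₁ hβ,
      ← lintegral_slopeWeight_mul_volume_section hm₂ hmem₂ hβ]
    refine lintegral_mono fun α => ?_
    obtain ⟨u, hu, c, hc0, hct, hc⟩ := exists_hausdorffMeasure_section_eq_mul hT α
    have := hsec u hu
    rw [hc, hc, ENNReal.mul_le_mul_iff_right hc0 hct] at this
    exact mul_le_mul_right this _
  have : (volume : Measure (ℝ × ℝ × ℝ)).IsAddHaarMeasure :=
    Measure.prod.instIsAddHaarMeasure volume (volume : Measure (ℝ × ℝ))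
  obtain ⟨c, -, -, hc⟩ := exists_hausdorffMeasure_image_eq_mul volume T hinj
  have hvol : ∀ K : Set (E 3), μH[3] K = c * volume (T ⁻¹' K) := fun K => by
    rw [← hc, Set.image_preimage_eq K hsurj]
    norm_num
  rw [hvol, hvol, volume_preimage_eq_lintegral_meridian hm₁ hmem₁,
    volume_preimage_eq_lintegral_meridian hm₂ hmem₂]
  gcongr c * (_ * ?_)
  exact setLIntegral_abs_fst_le_of_measure_cone_le hD₁ hconv h0 hfst hsnd hm₂ hcone
end
end

section
/- (Meyer.) Let n ≥ 2, let K₁ = {x ∈ ℝⁿ : |x₁| + ⋯ + |xₙ| ≤ 1} be the centered cross-polytope, and let K₂ be a centered convex body in ℝⁿ with λ_{n−1}(K₁ ∩ u^⊥) ≤ λ_{n−1}(K₂ ∩ u^⊥) for all u ∈ S^{n−1}. Then λ_n(K₁) ≤ λ_n(K₂). -/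
open MeasureTheory Metric
open scoped RealInnerProductSpace ENNReal

noncomputable section

lemma integrable_exp_neg_mul_abs {a : ℝ} (ha : 0 < a) :
    Integrable (fun x : ℝ => Complex.exp (-(a * |x|) : ℝ)) := by
  have h : Integrable (fun x : ℝ => Real.exp (-(a * |x|))) := by
    rw [← integrableOn_univ, ← Set.Iic_union_Ioi (a := (0 : ℝ)), integrableOn_union]
    constructor
    · refine (integrableOn_exp_mul_Iic ha 0).congr_fun (fun x hx => ?_) measurableSet_Iic
      simp [abs_of_nonpos (Set.mem_Iic.mp hx)]
    · refine (integrableOn_exp_mul_Ioi (neg_lt_zero.mpr ha) 0).congr_fun (fun x hx => ?_)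
        measurableSet_Ioi
      simp [abs_of_pos (Set.mem_Ioi.mp hx)]
  simpa using h.ofReal (𝕜 := ℂ)

open ProbabilityTheory FourierTransform in
/-- The Fourier transform of `exp (-a|x|)` is a Cauchy density. -/
lemma fourier_exp_neg_mul_abs {a : NNReal} (ha : a ≠ 0) (w : ℝ) :
    𝓕 (fun x : ℝ => Complex.exp (-(a * |x|) : ℝ)) w
      = (2 * Real.pi * cauchyPDFReal 0 a (2 * Real.pi * w) : ℝ) := by
  have ha' : (0 : ℝ) < a := by positivity
  rw [Real.fourier_real_eq_integral_exp_smul]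
  have hint : Integrable (fun x : ℝ => Complex.exp (↑(-2 * Real.pi * x * w) * Complex.I) •
      Complex.exp (-(a * |x|) : ℝ)) := by
    refine (integrable_exp_neg_mul_abs ha').bdd_mul (c := 1) (by fun_prop) (ae_of_all _ fun x => ?_)
    rw [Complex.norm_exp_ofReal_mul_I]
  rw [← intervalIntegral.integral_Iic_add_Ioi hint.integrableOn hint.integrableOn (b := 0)]
  have e1 : ∫ x in Set.Iic (0 : ℝ), Complex.exp (↑(-2 * Real.pi * x * w) * Complex.I) •
      Complex.exp (-(a * |x|) : ℝ) = ((a : ℂ) - 2 * Real.pi * w * Complex.I)⁻¹ := by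
    rw [setIntegral_congr_fun (g := fun x : ℝ =>
      Complex.exp (((a : ℂ) - 2 * Real.pi * w * Complex.I) * x)) measurableSet_Iic]
    · rw [integral_exp_mul_complex_Iic (by simpa using ha')]
      simp
    · intro x hx
      simp only [smul_eq_mul, ← Complex.exp_add, abs_of_nonpos (Set.mem_Iic.mp hx)]
      congr 1
      push_cast
      ring
  have e2 : ∫ x in Set.Ioi (0 : ℝ), Complex.exp (↑(-2 * Real.pi * x * w) * Complex.I) •
      Complex.exp (-(a * |x|) : ℝ) = ((a : ℂ) + 2 * Real.pi * w * Complex.I)⁻¹ := by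
    rw [setIntegral_congr_fun (g := fun x : ℝ =>
      Complex.exp ((-((a : ℂ) + 2 * Real.pi * w * Complex.I)) * x)) measurableSet_Ioi]
    · rw [integral_exp_mul_complex_Ioi (by simpa using ha'), Complex.ofReal_zero, mul_zero,
        Complex.exp_zero, neg_div_neg_eq, one_div]
    · intro x hx
      simp only [smul_eq_mul, ← Complex.exp_add, abs_of_pos (Set.mem_Ioi.mp hx)]
      congr 1
      push_cast
      ring
  rw [e1, e2, cauchyPDFReal_def]
  have h1 : (a : ℂ) - 2 * Real.pi * w * Complex.I ≠ 0 := fun h => by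
    have := congrArg Complex.re h
    simp at this
    exact ha this
  have h2 : (a : ℂ) + 2 * Real.pi * w * Complex.I ≠ 0 := fun h => by
    have := congrArg Complex.re h
    simp at this
    exact ha this
  have h3 : ((a : ℂ) - 2 * Real.pi * w * Complex.I) * (a + 2 * Real.pi * w * Complex.I)
      = (2 * Real.pi * w) ^ 2 + a ^ 2 := by
    linear_combination (-(2 * Real.pi * w : ℂ) ^ 2) * Complex.I_sq
  have e3 : ((a : ℂ) - 2 * Real.pi * w * Complex.I)⁻¹ + (a + 2 * Real.pi * w * Complex.I)⁻¹
      = 2 * a * ((2 * Real.pi * w) ^ 2 + a ^ 2 : ℂ)⁻¹ := by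
    rw [← h3]
    field_simp
    ring
  rw [e3, sub_zero]
  push_cast
  field_simp

open ProbabilityTheory FourierTransform in
/-- The characteristic function of the centered Cauchy distribution. -/
lemma charFun_cauchyMeasure_zero {a : NNReal} (ha : a ≠ 0) (t : ℝ) :
    charFun (cauchyMeasure 0 a) t = Complex.exp (-(a * |t|) : ℝ) := by
  have ha' : (0 : ℝ) < a := by positivity
  have hF : 𝓕 (fun x : ℝ => Complex.exp (-(a * |x|) : ℝ))
      = fun w : ℝ => ((2 * Real.pi * cauchyPDFReal 0 a (2 * Real.pi * w) : ℝ) : ℂ) :=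
    funext fun w => fourier_exp_neg_mul_abs ha w
  have hinv := (integrable_exp_neg_mul_abs ha').fourierInv_fourier_eq (v := t) (by
    rw [hF]
    exact (((integrable_cauchyPDFReal 0).comp_mul_left'
      (by positivity : 2 * Real.pi ≠ 0)).const_mul _).ofReal) (by fun_prop)
  rw [← hinv, hF, Real.fourierInv_eq', charFun_apply_real, cauchyMeasure_of_scale_ne_zero _ ha,
    integral_withDensity_eq_integral_toReal_smul (by fun_prop) (by simp [cauchyPDF])]
  have := Measure.integral_comp_mul_left 
    (fun u : ℝ => Complex.exp (t * u * Complex.I) * cauchyPDFReal 0 a u) (2 * Real.pi)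
  rw [abs_of_pos (by positivity), eq_inv_smul_iff₀ (by positivity), Complex.real_smul,
    ← integral_const_mul] at this
  refine Eq.trans (integral_congr_ae (ae_of_all _ fun x => ?_))
    (this.symm.trans (integral_congr_ae (ae_of_all _ fun x => ?_)))
  · simp only [cauchyPDF, ENNReal.toReal_ofReal (cauchyPDF_pos _ ha _).le, Complex.real_smul,
      mul_comm]
  · have hx : (2 * Real.pi * inner ℝ x t : ℝ) = t * (2 * Real.pi * x) := by
      rw [Real.inner_apply]; ring
    simp only [smul_eq_mul, hx]
    push_cast
    ring

open ProbabilityTheory in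
/-- A linear form in independent standard Cauchy variables is Cauchy, with scale the `ℓ¹`-norm of
the coefficients. -/
lemma map_sum_mul_pi_cauchyMeasure {m : ℕ} (x : Fin m → ℝ) {a : NNReal} (ha : a ≠ 0)
    (hx : ∑ i, |x i| = a) :
    (Measure.pi fun _ : Fin m => cauchyMeasure 0 1).map (fun y => ∑ i, x i * y i)
      = cauchyMeasure 0 a := by
  have hm : Measurable fun y : Fin m → ℝ => ∑ i, x i * y i := by fun_prop
  have : IsProbabilityMeasure ((Measure.pi fun _ : Fin m => cauchyMeasure 0 1).map
      (fun y => ∑ i, x i * y i)) := Measure.isProbabilityMeasure_map hm.aemeasurable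
  refine Measure.ext_of_charFun (funext fun t => ?_)
  rw [charFun_cauchyMeasure_zero ha, charFun_apply_real,
    integral_map hm.aemeasurable (by fun_prop)]
  have h : ∀ y : Fin m → ℝ, Complex.exp (t * (∑ i, x i * y i : ℝ) * Complex.I)
      = ∏ i, Complex.exp ((t * x i : ℝ) * y i * Complex.I) := fun y => by
    rw [← Complex.exp_sum]
    congr 1
    push_cast
    rw [Finset.mul_sum, Finset.sum_mul]
    exact Finset.sum_congr rfl fun i _ => by ring
  simp_rw [h]
  rw [integral_fintype_prod_eq_prod (fun i (s : ℝ) => Complex.exp ((t * x i : ℝ) * s * Complex.I))]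
  simp_rw [← charFun_apply_real, charFun_cauchyMeasure_zero one_ne_zero, ← Complex.exp_sum, ← hx]
  congr 1
  push_cast
  rw [Finset.sum_mul, ← Finset.sum_neg_distrib]
  exact Finset.sum_congr rfl fun i _ => by simp [abs_mul, mul_comm]

/-- The Hausdorff measure of the image of a set under an injective linear map is a fixed multiple
of its Haar measure. -/
lemma exists_hausdorffMeasure_image_eq {V F : Type*}
    [NormedAddCommGroup V] [NormedSpace ℝ V] [FiniteDimensional ℝ V] [MeasurableSpace V]
    [BorelSpace V] [NormedAddCommGroup F] [NormedSpace ℝ F] [MeasurableSpace F] [BorelSpace F]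
    (μ : Measure V) [μ.IsAddHaarMeasure] (L : V →ₗ[ℝ] F) (hL : Function.Injective L) :
    ∃ c : ℝ≥0∞, c ≠ 0 ∧ c ≠ ∞ ∧
      ∀ B : Set V, μH[(Module.finrank ℝ V : ℝ)] (L '' B) = c * μ B := by
  let e : V ≃L[ℝ] LinearMap.range L := (LinearEquiv.ofInjective L hL).toContinuousLinearEquiv
  have hfr : Module.finrank ℝ V = Module.finrank ℝ (LinearMap.range L) :=
    e.toLinearEquiv.finrank_eq
  have : (μ.map e).IsAddHaarMeasure := e.isAddHaarMeasure_map μ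
  have hH : (μH[(Module.finrank ℝ (LinearMap.range L) : ℝ)] :
    Measure (LinearMap.range L)).IsAddHaarMeasure := isAddHaarMeasure_hausdorffMeasure
  have key := Measure.isAddLeftInvariant_eq_smul
    (μH[(Module.finrank ℝ (LinearMap.range L) : ℝ)] : Measure (LinearMap.range L)) (μ.map e)
  have hc := Measure.addHaarScalarFactor_pos_of_isAddHaarMeasure
    (μH[(Module.finrank ℝ (LinearMap.range L) : ℝ)] : Measure (LinearMap.range L)) (μ.map e)
  refine ⟨_, ENNReal.coe_ne_zero.mpr hc.ne', ENNReal.coe_ne_top, fun B => ?_⟩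
  have himg : L '' B = Subtype.val '' (e '' B) := by
    rw [Set.image_image]; rfl
  rw [himg, (isometry_subtype_coe).hausdorffMeasure_image (Or.inl (by positivity)), hfr]
  refine (congrArg (fun ν : Measure (LinearMap.range L) => ν (e '' B)) key).trans ?_
  simp only [Measure.smul_apply]
  rw [show μ.map e (e '' B) = μ (e ⁻¹' (e '' B)) from
    e.toHomeomorph.toMeasurableEquiv.map_apply _, Set.preimage_image_eq _ e.injective]
  rfl

lemma integrable_and_integral_inv_one_add_sq_mul {a z : ℝ} (ha : 0 < a)
    (hz : 0 < z) (haz : a ≠ z) :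
    Integrable (fun t : ℝ => (1 + t ^ 2)⁻¹ * (a * (a ^ 2 + (t * z) ^ 2)⁻¹)) ∧
    ∫ t : ℝ, (1 + t ^ 2)⁻¹ * (a * (a ^ 2 + (t * z) ^ 2)⁻¹) = Real.pi * (z + a)⁻¹ := by
  have hd : a ^ 2 - z ^ 2 ≠ 0 := by
    rw [sq_sub_sq]; exact mul_ne_zero (by positivity) (sub_ne_zero.mpr haz)
  have hf : (fun t : ℝ => (1 + t ^ 2)⁻¹ * (a * (a ^ 2 + (t * z) ^ 2)⁻¹))
      = fun t => a / (a ^ 2 - z ^ 2) * (1 + t ^ 2)⁻¹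
        - z ^ 2 / (a * (a ^ 2 - z ^ 2)) * (1 + (z / a * t) ^ 2)⁻¹ := by
    ext t
    have h1 : 1 + t ^ 2 ≠ 0 := by positivity
    have h2 : a ^ 2 + (t * z) ^ 2 ≠ 0 := by positivity
    have h3 : 1 + (z / a * t) ^ 2 = (a ^ 2 + (t * z) ^ 2) / a ^ 2 := by field_simp
    rw [h3]
    field_simp
    ring
  have i1 := integrable_inv_one_add_sq.const_mul (a / (a ^ 2 - z ^ 2))
  have i2 := (integrable_inv_one_add_sq.comp_mul_left' (by positivity : z / a ≠ 0)).const_mul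
    (z ^ 2 / (a * (a ^ 2 - z ^ 2)))
  rw [hf]
  refine ⟨i1.sub i2, ?_⟩
  rw [integral_sub i1 i2, integral_const_mul, integral_const_mul,
    Measure.integral_comp_mul_left (fun t : ℝ => (1 + t ^ 2)⁻¹), integral_univ_inv_one_add_sq,
    abs_of_pos (by positivity), smul_eq_mul]
  field_simp
  ring

open ProbabilityTheory in
lemma lintegral_cauchyPDF_mul_cauchyPDF {a : NNReal} (ha : a ≠ 0) {z : ℝ} (hz : z ≠ 0)
    (haz : (a : ℝ) ≠ |z|) :
    ∫⁻ t, cauchyPDF 0 1 t * cauchyPDF 0 a (t * z) = ENNReal.ofReal (Real.pi * (|z| + a))⁻¹ := by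
  obtain ⟨h1, h2⟩ := integrable_and_integral_inv_one_add_sq_mul (a := a) (z := |z|) (by positivity)
    (by positivity) haz
  have hf : ∀ t, cauchyPDF 0 1 t * cauchyPDF 0 a (t * z) = ENNReal.ofReal
      (Real.pi⁻¹ ^ 2 * ((1 + t ^ 2)⁻¹ * (a * (a ^ 2 + (t * |z|) ^ 2)⁻¹))) := fun t => by
    rw [cauchyPDF, cauchyPDF, ← ENNReal.ofReal_mul (cauchyPDF_pos _ one_ne_zero _).le,
      cauchyPDFReal_def, cauchyPDFReal_def, mul_pow t |z|, sq_abs]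
    congr 1
    rw [NNReal.coe_one, sub_zero, sub_zero, mul_pow, add_comm (1 : ℝ), one_pow,
      add_comm (t ^ 2 * z ^ 2)]
    ring
  simp_rw [hf]
  rw [← ofReal_integral_eq_lintegral_ofReal (h1.const_mul _)
    (ae_of_all _ fun t => by positivity), integral_const_mul, h2]
  congr 1
  field_simp

open ProbabilityTheory in
lemma lintegral_cauchyMeasure_comp_div {a : NNReal} (ha : a ≠ 0) {t : ℝ} (ht : t ≠ 0)
    {g : ℝ → ℝ≥0∞} (hg : Measurable g) :
    ENNReal.ofReal |t⁻¹| * ∫⁻ s, g (s / t) ∂(cauchyMeasure 0 a)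
      = ∫⁻ z, cauchyPDF 0 a (t * z) * g z := by
  rw [cauchyMeasure_of_scale_ne_zero _ ha,
    lintegral_withDensity_eq_lintegral_mul _ (by fun_prop) (by fun_prop),
    ← smul_eq_mul, ← lintegral_smul_measure, ← Real.map_volume_mul_left ht,
    lintegral_map (by fun_prop) (by fun_prop)]
  simp [mul_div_cancel_left₀ _ ht]

open ProbabilityTheory in
/-- The average over `(t, y)`, with independent standard Cauchy coordinates, of the sections of
`B` by the hyperplanes `t z = ∑ i, x i * y i` is the integral over `B` of the inverse of the
`ℓ¹`-norm. -/
lemma lintegral_section_cauchyMeasure {m : ℕ} (hm : 1 ≤ m) {B : Set (ℝ × (Fin m → ℝ))}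
    (hB : MeasurableSet B) :
    ∫⁻ t, ENNReal.ofReal |t⁻¹| * ∫⁻ y, volume {x : Fin m → ℝ | ((∑ i, x i * y i) / t, x) ∈ B}
      ∂(Measure.pi fun _ : Fin m => cauchyMeasure 0 1) ∂(cauchyMeasure 0 1)
      = ∫⁻ p in B, ENNReal.ofReal (Real.pi * (|p.1| + ∑ i, |p.2 i|))⁻¹ := by
  let f : ℝ × (Fin m → ℝ) → ℝ≥0∞ := B.indicator 1
  have hf : Measurable f := measurable_one.indicator hB
  let a : (Fin m → ℝ) → NNReal := fun x => ∑ i, ‖x i‖₊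
  have hac : ∀ x, (a x : ℝ) = ∑ i, |x i| := fun x => by simp [a]
  have ham : Measurable a := by fun_prop
  have ha0 : ∀ᵐ x : Fin m → ℝ, a x ≠ 0 := by
    have : Nonempty (Fin m) := ⟨⟨0, hm⟩⟩
    filter_upwards [Measure.ae_ne volume (0 : Fin m → ℝ)] with x hx h
    refine hx (funext fun i => ?_)
    have := (Finset.sum_eq_zero_iff.mp h) i (Finset.mem_univ i)
    simpa using this
  have ht0 : ∀ᵐ t ∂(cauchyMeasure 0 1), t ≠ 0 := by
    rw [cauchyMeasure_of_scale_ne_zero _ one_ne_zero]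
    exact (withDensity_absolutelyContinuous _ _).ae_le (Measure.ae_ne volume (0 : ℝ))
  have hpdf : Measurable fun q : (ℝ × (Fin m → ℝ)) × ℝ => cauchyPDF 0 (a q.1.2) (q.1.1 * q.2) := by
    unfold cauchyPDF cauchyPDFReal
    fun_prop
  have hstep : ∀ᵐ t ∂(cauchyMeasure 0 1), ENNReal.ofReal |t⁻¹| *
      ∫⁻ y, volume {x : Fin m → ℝ | ((∑ i, x i * y i) / t, x) ∈ B}
        ∂(Measure.pi fun _ : Fin m => cauchyMeasure 0 1)
      = ∫⁻ x, ∫⁻ z, cauchyPDF 0 (a x) (t * z) * f (z, x) := by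
    filter_upwards [ht0] with t ht
    have h1 : ∀ y : Fin m → ℝ, volume {x : Fin m → ℝ | ((∑ i, x i * y i) / t, x) ∈ B}
        = ∫⁻ x, f ((∑ i, x i * y i) / t, x) := fun y => by
      exact (lintegral_indicator_one (hB.preimage
        (f := fun x : Fin m → ℝ => ((∑ i, x i * y i) / t, x)) (by fun_prop))).symm
    simp_rw [h1]
    rw [lintegral_lintegral_swap (Measurable.aemeasurable (by fun_prop)),
      ← lintegral_const_mul _ (by fun_prop)]
    refine lintegral_congr_ae ?_
    filter_upwards [ha0] with x hx
    rw [← lintegral_cauchyMeasure_comp_div hx ht (g := fun z => f (z, x)) (by fun_prop),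
      ← map_sum_mul_pi_cauchyMeasure x hx (hac x).symm, lintegral_map (by fun_prop) (by fun_prop)]
  rw [lintegral_congr_ae hstep]
  rw [lintegral_lintegral_swap (Measurable.aemeasurable (by
    exact Measurable.lintegral_prod_right (hpdf.mul (by fun_prop))))]
  rw [← lintegral_indicator hB, Measure.volume_eq_prod, lintegral_prod_symm' _ (by
    exact Measurable.indicator (by fun_prop) hB)]
  refine lintegral_congr_ae ?_
  filter_upwards [ha0] with x hx
  rw [lintegral_lintegral_swap (Measurable.aemeasurable (by
    unfold cauchyPDF cauchyPDFReal; fun_prop))]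
  refine lintegral_congr_ae ?_
  filter_upwards [Measure.ae_ne volume (0 : ℝ), Measure.ae_ne volume (a x : ℝ),
    Measure.ae_ne volume (-(a x) : ℝ)] with z hz h1 h2
  have haz : (a x : ℝ) ≠ |z| := fun h => by
    rcases abs_choice z with h' | h' <;> rw [h'] at h
    · exact h1 h.symm
    · exact h2 (by linarith)
  rw [lintegral_mul_const _ (by fun_prop), cauchyMeasure_of_scale_ne_zero _ one_ne_zero,
    lintegral_withDensity_eq_lintegral_mul _ (by fun_prop) (by fun_prop)]
  simp only [Pi.mul_apply]
  rw [lintegral_cauchyPDF_mul_cauchyPDF hx hz haz, hac]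
  by_cases hmem : (z, x) ∈ B <;> simp [f, hmem]

/-- A weighted comparison: if a superlevel set `A` of the weight `w` has finite weighted measure
not exceeding that of `B`, then its measure does not exceed that of `B`. -/
lemma measure_le_of_setLIntegral_superlevel_le {α : Type*} [MeasurableSpace α] {μ : Measure α}
    {w : α → ℝ≥0∞} {A B : Set α} (hA : MeasurableSet A) (hB : MeasurableSet B) {c : ℝ≥0∞}
    (hc : c ≠ 0) (hc' : c ≠ ∞) (hwA : ∀ᵐ x ∂μ, x ∈ A → c ≤ w x) (hwA' : ∀ x ∉ A, w x ≤ c)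
    (hfin : ∫⁻ x in A, w x ∂μ ≠ ∞) (hle : ∫⁻ x in A, w x ∂μ ≤ ∫⁻ x in B, w x ∂μ) :
    μ A ≤ μ B := by
  have h1 : ∫⁻ x in A \ B, w x ∂μ ≤ ∫⁻ x in B \ A, w x ∂μ := by
    rw [← lintegral_inter_add_sdiff w A hB, ← lintegral_inter_add_sdiff w B hA,
      Set.inter_comm B A] at hle
    refine (ENNReal.add_le_add_iff_left (ne_top_of_le_ne_top hfin ?_)).mp hle
    exact lintegral_mono_set Set.inter_subset_left
  have h2 : c * μ (A \ B) ≤ ∫⁻ x in A \ B, w x ∂μ := by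
    rw [← setLIntegral_const]
    refine setLIntegral_mono_ae' (hA.diff hB) ?_
    filter_upwards [hwA] with x hx hxm using hx hxm.1
  have h3 : ∫⁻ x in B \ A, w x ∂μ ≤ c * μ (B \ A) := by
    rw [← setLIntegral_const]
    exact setLIntegral_mono' (hB.diff hA) fun x hx => hwA' x hx.2
  have h4 : μ (A \ B) ≤ μ (B \ A) :=
    (ENNReal.mul_le_mul_iff_right hc hc').mp (h2.trans (h1.trans h3))
  rw [← measure_inter_add_sdiff A hB, ← measure_inter_add_sdiff B hA, Set.inter_comm B A]
  gcongr

lemma norm_le_abs_add_sum_abs {m : ℕ} (p : ℝ × (Fin m → ℝ)) : ‖p‖ ≤ |p.1| + ∑ i, |p.2 i| := by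
  have h0 : 0 ≤ ∑ i, |p.2 i| := Finset.sum_nonneg fun i _ => abs_nonneg _
  refine max_le (by simpa using h0) ?_
  refine (pi_norm_le_iff_of_nonneg (by positivity)).mpr fun i => ?_
  have := Finset.single_le_sum (f := fun i => |p.2 i|) (fun i _ => abs_nonneg _) (Finset.mem_univ i)
  simp only [Real.norm_eq_abs]
  linarith [abs_nonneg p.1]

instance isAddHaarMeasure_volume_real_prod {m : ℕ} :
    (volume : Measure (ℝ × (Fin m → ℝ))).IsAddHaarMeasure :=
  inferInstanceAs ((volume : Measure ℝ).prod (volume : Measure (Fin m → ℝ))).IsAddHaarMeasure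

lemma setLIntegral_inv_abs_add_sum_abs_ne_top {m : ℕ} (hm : 1 ≤ m) :
    ∫⁻ p in {p : ℝ × (Fin m → ℝ) | |p.1| + ∑ i, |p.2 i| ≤ 1},
      ENNReal.ofReal (Real.pi * (|p.1| + ∑ i, |p.2 i|))⁻¹ ≠ ∞ := by
  have hmeas : MeasurableSet {p : ℝ × (Fin m → ℝ) | |p.1| + ∑ i, |p.2 i| ≤ 1} :=
    measurableSet_le (by fun_prop) (by fun_prop)
  have hint : Integrable (fun p : ℝ × (Fin m → ℝ) =>
      (Set.Iic (1 : ℝ)).indicator (fun r => r⁻¹) ‖p‖) := by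
    rw [integrable_fun_norm_addHaar volume (f := (Set.Iic (1 : ℝ)).indicator (fun r => r⁻¹))]
    have hfr : Module.finrank ℝ (ℝ × (Fin m → ℝ)) - 1 = m := by simp
    rw [hfr]
    have h1 : IntegrableOn (fun y : ℝ => y ^ (m - 1)) (Set.Ioc 0 1) :=
      (Continuous.integrableOn_Icc (by fun_prop)).mono_set Set.Ioc_subset_Icc_self
    have h2 : IntegrableOn ((Set.Ioc (0 : ℝ) 1).indicator fun y : ℝ => y ^ (m - 1)) (Set.Ioi 0) :=
      ((integrable_indicator_iff measurableSet_Ioc).mpr h1).integrableOn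
    refine h2.congr_fun (fun y hy => ?_) measurableSet_Ioi
    have hy0 : (0 : ℝ) < y := hy
    by_cases hy1 : y ≤ 1
    · obtain ⟨k, rfl⟩ : ∃ k, m = k + 1 := ⟨m - 1, by omega⟩
      simp [hy0, hy1, pow_succ, hy0.ne']
    · simp [hy1]
  refine ne_top_of_le_ne_top hint.lintegral_lt_top.ne ?_
  rw [← lintegral_indicator hmeas]
  refine lintegral_mono fun p => ?_
  by_cases hp : |p.1| + ∑ i, |p.2 i| ≤ 1
  · have hn := norm_le_abs_add_sum_abs p
    rw [Set.indicator_of_mem (by exact hp), Set.indicator_of_mem (by exact hn.trans hp)]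
    refine ENNReal.ofReal_le_ofReal ?_
    rcases (norm_nonneg p).eq_or_lt with h | h
    · have : p = 0 := norm_eq_zero.mp h.symm
      simp [this]
    · refine inv_anti₀ h (hn.trans ?_)
      exact le_mul_of_one_le_left (h.le.trans hn) (by linarith [Real.pi_gt_three])
  · rw [Set.indicator_of_notMem (by exact hp)]
    exact zero_le

lemma volume_crossPolytope_le {m : ℕ} (hm : 1 ≤ m) {B : Set (ℝ × (Fin m → ℝ))}
    (hB : MeasurableSet B)
    (hsec : ∀ (t : ℝ) (y : Fin m → ℝ), t ≠ 0 →
      volume {x : Fin m → ℝ | ((∑ i, x i * y i) / t, x) ∈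
          {p : ℝ × (Fin m → ℝ) | |p.1| + ∑ i, |p.2 i| ≤ 1}}
        ≤ volume {x : Fin m → ℝ | ((∑ i, x i * y i) / t, x) ∈ B}) :
    volume {p : ℝ × (Fin m → ℝ) | |p.1| + ∑ i, |p.2 i| ≤ 1} ≤ volume B := by
  have hmeas : MeasurableSet {p : ℝ × (Fin m → ℝ) | |p.1| + ∑ i, |p.2 i| ≤ 1} :=
    measurableSet_le (by fun_prop) (by fun_prop)
  have hpi := Real.pi_pos
  refine measure_le_of_setLIntegral_superlevel_le
    (w := fun p => ENNReal.ofReal (Real.pi * (|p.1| + ∑ i, |p.2 i|))⁻¹)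
    (c := ENNReal.ofReal Real.pi⁻¹) hmeas hB (by simpa using hpi) ENNReal.ofReal_ne_top ?_ ?_
    (setLIntegral_inv_abs_add_sum_abs_ne_top hm) ?_
  · filter_upwards [Measure.ae_ne volume (0 : ℝ × (Fin m → ℝ))] with p hp hpB
    have h0 := (norm_pos_iff.mpr hp).trans_le (norm_le_abs_add_sum_abs p)
    refine ENNReal.ofReal_le_ofReal (inv_anti₀ (by positivity) ?_)
    exact mul_le_of_le_one_right hpi.le hpB
  · intro p hp
    have hp' : 1 ≤ |p.1| + ∑ i, |p.2 i| := (not_le.mp hp).le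
    exact ENNReal.ofReal_le_ofReal (inv_anti₀ hpi (le_mul_of_one_le_right hpi.le hp'))
  · rw [← lintegral_section_cauchyMeasure hm hmeas, ← lintegral_section_cauchyMeasure hm hB]
    refine lintegral_mono fun t => ?_
    rcases eq_or_ne t 0 with rfl | ht
    · simp
    · exact mul_le_mul_right (lintegral_mono fun y => hsec t y ht) _

/-- Splitting off the first coordinate of `ℝ^(m+1)`. -/
def consLinear (m : ℕ) : (ℝ × (Fin m → ℝ)) →ₗ[ℝ] E (m + 1) where
  toFun p := WithLp.toLp 2 (Fin.cons p.1 p.2)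
  map_add' p q := by
    ext i
    refine Fin.cases ?_ (fun j => ?_) i <;> simp
  map_smul' c p := by
    ext i
    refine Fin.cases ?_ (fun j => ?_) i <;> simp

@[simp] lemma consLinear_apply_zero {m : ℕ} (p : ℝ × (Fin m → ℝ)) : consLinear m p 0 = p.1 := rfl

@[simp] lemma consLinear_apply_succ {m : ℕ} (p : ℝ × (Fin m → ℝ)) (i : Fin m) :
    consLinear m p i.succ = p.2 i := rfl

lemma consLinear_injective (m : ℕ) : Function.Injective (consLinear m) := fun p q h =>
  Prod.ext (by simpa using congrArg (fun x : E (m + 1) => x 0) h)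
    (funext fun i => by simpa using congrArg (fun x : E (m + 1) => x i.succ) h)

lemma consLinear_surjective (m : ℕ) : Function.Surjective (consLinear m) := fun x =>
  ⟨(x 0, fun i => x i.succ), by
    ext i
    refine Fin.cases ?_ (fun j => ?_) i <;> simp⟩

/-- The Hausdorff measures of the sections by a hyperplane are proportional to the Lebesgue
measures of their parametrizations as graphs over the last coordinates. -/
lemma exists_hausdorffMeasure_inter_hyperplane_eq {m : ℕ} {t : ℝ} (ht : t ≠ 0) (y : Fin m → ℝ) :
    ∃ u ∈ sphere (0 : E (m + 1)) 1, ∃ c : ℝ≥0∞, c ≠ 0 ∧ c ≠ ∞ ∧ ∀ K : Set (E (m + 1)),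
      μH[((m + 1 : ℕ) : ℝ) - 1] (K ∩ hyperplane u)
        = c * volume {x : Fin m → ℝ | ((∑ i, x i * y i) / t, x) ∈ consLinear m ⁻¹' K} := by
  let v : E (m + 1) := consLinear m (t, -y)
  have hv : v ≠ 0 := fun h => ht (congrArg (fun x : E (m + 1) => x 0) h)
  let G : (Fin m → ℝ) →ₗ[ℝ] (ℝ × (Fin m → ℝ)) :=
    { toFun := fun x => ((∑ i, x i * y i) / t, x)
      map_add' := fun x x' => by
        simp [add_mul, Finset.sum_add_distrib, add_div]
      map_smul' := fun c x => by
        simp [mul_assoc, ← Finset.mul_sum, mul_div_assoc] }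
  have hinj : Function.Injective (consLinear m ∘ₗ G) :=
    (consLinear_injective m).comp fun x x' h => congrArg Prod.snd h
  obtain ⟨c, hc, hc', h⟩ := exists_hausdorffMeasure_image_eq volume (consLinear m ∘ₗ G) hinj
  refine ⟨‖v‖⁻¹ • v, by simp [norm_smul, hv], c, hc, hc', fun K => ?_⟩
  rw [← h, Module.finrank_fin_fun, show ((m + 1 : ℕ) : ℝ) - 1 = m by push_cast; ring]
  congr 1
  have hinner : ∀ p : ℝ × (Fin m → ℝ), consLinear m p ∈ hyperplane (‖v‖⁻¹ • v) ↔
      p.1 = (∑ i, p.2 i * y i) / t := fun p => by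
    have : (inner ℝ (consLinear m p) v : ℝ) = p.1 * t - ∑ i, p.2 i * y i := by
      simp [v, PiLp.inner_apply, Fin.sum_univ_succ, mul_comm, sub_eq_add_neg]
    rw [hyperplane, Set.mem_ofPred_eq, inner_smul_right, this, mul_eq_zero,
      or_iff_right (inv_ne_zero (norm_ne_zero_iff.mpr hv)), sub_eq_zero, eq_div_iff ht]
  ext x
  constructor
  · rintro ⟨hxK, hxu⟩
    obtain ⟨⟨z, x⟩, rfl⟩ := consLinear_surjective m x
    have hz : z = (∑ i, x i * y i) / t := (hinner _).mp hxu
    subst hz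
    exact ⟨x, hxK, rfl⟩
  · rintro ⟨x, hx, rfl⟩
    exact ⟨hx, (hinner _).mpr rfl⟩

/-- (Meyer.) The Busemann–Petty problem has a positive answer in `ℝⁿ` when `K₁`
is the centered cross-polytope. -/
theorem busemann_petty_cross_polytope (n : ℕ) (hn : 2 ≤ n) (K₂ : Set (E n))
    (hK₂ : IsConvexBody K₂) (hc₂ : IsCentered K₂)
    (hsec : ∀ u ∈ sphere (0 : E n) 1,
      μH[(n : ℝ) - 1] ({x : E n | ∑ i, |x i| ≤ 1} ∩ hyperplane u)
        ≤ μH[(n : ℝ) - 1] (K₂ ∩ hyperplane u)) :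
    μH[(n : ℝ)] {x : E n | ∑ i, |x i| ≤ 1} ≤ μH[(n : ℝ)] K₂ := by
  obtain ⟨m, rfl⟩ : ∃ m, n = m + 1 := ⟨n - 1, by omega⟩
  obtain ⟨c, -, -, h⟩ := exists_hausdorffMeasure_image_eq volume (consLinear m)
    (consLinear_injective m)
  have hfr : Module.finrank ℝ (ℝ × (Fin m → ℝ)) = m + 1 := by simp [add_comm]
  have hH : ∀ K : Set (E (m + 1)), μH[((m + 1 : ℕ) : ℝ)] K = c * volume (consLinear m ⁻¹' K) :=
    fun K => by rw [← h, hfr, Set.image_preimage_eq _ (consLinear_surjective m)]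
  have hpre : consLinear m ⁻¹' {x : E (m + 1) | ∑ i, |x i| ≤ 1}
      = {p : ℝ × (Fin m → ℝ) | |p.1| + ∑ i, |p.2 i| ≤ 1} := by
    ext p
    simp [Fin.sum_univ_succ]
  rw [hH, hH, hpre]
  refine mul_le_mul_right (volume_crossPolytope_le (by omega)
    (hK₂.1.measurableSet.preimage (consLinear m).continuous_of_finiteDimensional.measurable)
    fun t y ht => ?_) _
  obtain ⟨u, hu, c', hc, hc', hs⟩ := exists_hausdorffMeasure_inter_hyperplane_eq ht y
  have := hsec u hu
  rwa [hs, hs, ENNReal.mul_le_mul_iff_right hc hc', hpre] at this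
end
end

section
/- (Busemann–Petty, via the Busemann intersection inequality.) Let n ≥ 2, let K₁ be a centered ellipsoid in ℝⁿ (the image of the closed Euclidean unit ball under an invertible linear map), and let K₂ be a centered convex body in ℝⁿ with λ_{n−1}(K₁ ∩ u^⊥) ≤ λ_{n−1}(K₂ ∩ u^⊥) for all u ∈ S^{n−1}. Then λ_n(K₁) ≤ λ_n(K₂). -/
open MeasureTheory Metric
open scoped RealInnerProductSpace ENNReal

noncomputable section

open ProbabilityTheory Set Module

section LinearSections

variable {U : Type*} [NormedAddCommGroup U] [InnerProductSpace ℝ U] [FiniteDimensional ℝ U]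
  [MeasurableSpace U] [BorelSpace U]

/-- One-dimensional marginals of the standard Gaussian measure. -/
lemma map_inner_stdGaussian (v : U) :
    (stdGaussian U).map (fun a ↦ ⟪v, a⟫) = gaussianReal 0 (‖v‖ ^ 2).toNNReal := by
  have h := IsGaussian.map_eq_gaussianReal (μ := stdGaussian U) (innerSL ℝ v)
  rwa [integral_strongDual_stdGaussian, variance_dual_stdGaussian, innerSL_apply_norm] at h

/-- A scale mixture of the one-dimensional Gaussian densities is `1 / (2 √(r² + t²))`. -/
lemma lintegral_mul_gaussianPDF_inv {r : ℝ} (hr : 0 < r) (t : ℝ) :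
    ∫⁻ s in Ioi (0 : ℝ), ENNReal.ofReal (s⁻¹ * Real.exp (-s ^ 2 / 2)) *
        gaussianPDF 0 ((s⁻¹ * r) ^ 2).toNNReal t =
      ENNReal.ofReal (2 * √(r ^ 2 + t ^ 2))⁻¹ := by
  have hq : 0 < r ^ 2 + t ^ 2 := by positivity
  set b : ℝ := (r ^ 2 + t ^ 2) / (2 * r ^ 2) with hb
  have hb0 : 0 < b := by positivity
  have key : ∀ s ∈ Ioi (0 : ℝ), ENNReal.ofReal (s⁻¹ * Real.exp (-s ^ 2 / 2)) *
        gaussianPDF 0 ((s⁻¹ * r) ^ 2).toNNReal t =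
      ENNReal.ofReal ((√(2 * Real.pi) * r)⁻¹ * Real.exp (-b * s ^ 2)) := by
    intro s (hs : 0 < s)
    rw [gaussianPDF, ← ENNReal.ofReal_mul (by positivity), gaussianPDFReal,
      Real.coe_toNNReal _ (by positivity)]
    congr 1
    have h1 : √(2 * Real.pi * (s⁻¹ * r) ^ 2) = √(2 * Real.pi) * (s⁻¹ * r) := by
      rw [Real.sqrt_mul (by positivity), Real.sqrt_sq (by positivity)]
    have h2 : -b * s ^ 2 = -s ^ 2 / 2 + -(t - 0) ^ 2 / (2 * (s⁻¹ * r) ^ 2) := by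
      rw [hb]; field_simp; ring
    rw [h1, h2, Real.exp_add]
    field_simp
  rw [setLIntegral_congr_fun measurableSet_Ioi key,
    ← ofReal_integral_eq_lintegral_ofReal
      ((integrable_exp_neg_mul_sq hb0).const_mul _).integrableOn
      (ae_of_all _ fun s ↦ by positivity),
    integral_const_mul, integral_gaussian_Ioi]
  congr 1
  have h3 : Real.pi / b = (2 * Real.pi) * r ^ 2 / (r ^ 2 + t ^ 2) := by
    rw [hb]; field_simp
  rw [h3, Real.sqrt_div (by positivity), Real.sqrt_mul (x := 2 * Real.pi) (by positivity),
    Real.sqrt_sq hr.le]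
  have : √(r ^ 2 + t ^ 2) ≠ 0 := by positivity
  field_simp

variable (μ : Measure U) [μ.IsAddHaarMeasure]

/-- A weighted average of the measures of the sections of `S` by the graphs of the linear
functionals `y ↦ ⟪a, y⟫` is the integral over `S` of the inverse distance to the origin. -/
lemma lintegral_measure_graph_section [Nontrivial U] {S : Set (U × ℝ)} (hS : MeasurableSet S) :
    ∫⁻ s in Ioi (0 : ℝ), ENNReal.ofReal (s⁻¹ * Real.exp (-s ^ 2 / 2)) *
        ∫⁻ a, μ {y | (y, ⟪s⁻¹ • a, y⟫) ∈ S} ∂(stdGaussian U) =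
      ∫⁻ p in S, ENNReal.ofReal (2 * √(‖p.1‖ ^ 2 + p.2 ^ 2))⁻¹ ∂(μ.prod volume) := by
  have hmeas : Measurable fun p : (ℝ × U) × U ↦ S.indicator (1 : U × ℝ → ℝ≥0∞)
      (p.1.2, ⟪p.1.1⁻¹ • p.1.2, p.2⟫) :=
    (measurable_one.indicator hS).comp (by fun_prop)
  have hw : Measurable fun s : ℝ ↦ ENNReal.ofReal (s⁻¹ * Real.exp (-s ^ 2 / 2)) := by fun_prop
  have h1 : ∀ s : ℝ, ∫⁻ a, μ {y | (y, ⟪s⁻¹ • a, y⟫) ∈ S} ∂(stdGaussian U) =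
      ∫⁻ y, ∫⁻ a, S.indicator 1 (y, ⟪s⁻¹ • y, a⟫) ∂(stdGaussian U) ∂μ := by
    intro s
    rw [lintegral_lintegral_swap]
    · refine lintegral_congr fun a ↦ ?_
      have hm : MeasurableSet {y | (y, ⟪s⁻¹ • a, y⟫) ∈ S} :=
        hS.preimage (f := fun y ↦ (y, ⟪s⁻¹ • a, y⟫)) (by fun_prop)
      rw [← lintegral_indicator_one hm]
      refine lintegral_congr fun y ↦ ?_
      have : ⟪s⁻¹ • y, a⟫ = ⟪s⁻¹ • a, y⟫ := by
        rw [real_inner_smul_left, real_inner_smul_left, real_inner_comm]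
      rw [this]
      rfl
    · exact (hmeas.comp (g := fun p : (ℝ × U) × U ↦ _)
        (f := fun p : U × U ↦ ((s, p.1), p.2)) (by fun_prop)).aemeasurable
  have h2 : ∀ y : U, y ≠ 0 → ∀ s ∈ Ioi (0 : ℝ),
      ∫⁻ a, S.indicator (1 : U × ℝ → ℝ≥0∞) (y, ⟪s⁻¹ • y, a⟫) ∂(stdGaussian U) =
      ∫⁻ t, gaussianPDF 0 ((s⁻¹ * ‖y‖) ^ 2).toNNReal t * S.indicator 1 (y, t) := by
    intro y hy s (hs : 0 < s)
    have hy' : 0 < ‖y‖ := norm_pos_iff.2 hy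
    have hnorm : ‖s⁻¹ • y‖ = s⁻¹ * ‖y‖ := by
      rw [norm_smul, Real.norm_of_nonneg (by positivity)]
    have hf : Measurable fun t : ℝ ↦ S.indicator (1 : U × ℝ → ℝ≥0∞) (y, t) :=
      (measurable_one.indicator hS).comp (by fun_prop)
    have hv : ((s⁻¹ * ‖y‖) ^ 2).toNNReal ≠ 0 := by
      rw [ne_eq, Real.toNNReal_eq_zero, not_le]; positivity
    rw [← lintegral_map (f := fun t : ℝ ↦ S.indicator (1 : U × ℝ → ℝ≥0∞) (y, t))
      (g := fun a ↦ ⟪s⁻¹ • y, a⟫) hf (by fun_prop), map_inner_stdGaussian, hnorm,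
      gaussianReal_of_var_ne_zero _ hv,
      lintegral_withDensity_eq_lintegral_mul _ (measurable_gaussianPDF _ _) hf]
    rfl
  have hmeas2 : Measurable fun p : ℝ × U ↦
      ∫⁻ a, S.indicator (1 : U × ℝ → ℝ≥0∞) (p.2, ⟪p.1⁻¹ • p.2, a⟫) ∂(stdGaussian U) :=
    hmeas.lintegral_prod_right'
  have hpdf : Measurable fun p : ℝ × ℝ × U ↦
      gaussianPDF 0 ((p.1⁻¹ * ‖p.2.2‖) ^ 2).toNNReal p.2.1 := by
    have := measurable_uncurry_gaussianPDF.comp (f := fun p : ℝ × ℝ × U ↦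
      ((0 : ℝ), ((p.1⁻¹ * ‖p.2.2‖) ^ 2).toNNReal, p.2.1)) (by fun_prop)
    exact this
  calc
    _ = ∫⁻ s in Ioi (0 : ℝ), ∫⁻ y, ENNReal.ofReal (s⁻¹ * Real.exp (-s ^ 2 / 2)) *
          ∫⁻ a, S.indicator 1 (y, ⟪s⁻¹ • y, a⟫) ∂(stdGaussian U) ∂μ := by
      refine lintegral_congr fun s ↦ ?_
      rw [h1, lintegral_const_mul]
      exact hmeas2.comp (f := fun y : U ↦ (s, y)) (by fun_prop)
    _ = ∫⁻ y, (∫⁻ s in Ioi (0 : ℝ), ENNReal.ofReal (s⁻¹ * Real.exp (-s ^ 2 / 2)) *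
          ∫⁻ a, S.indicator 1 (y, ⟪s⁻¹ • y, a⟫) ∂(stdGaussian U)) ∂μ := by
      rw [lintegral_lintegral_swap]
      exact ((hw.comp measurable_fst).mul hmeas2).aemeasurable
    _ = ∫⁻ y, (∫⁻ t, S.indicator
          (fun p ↦ ENNReal.ofReal (2 * √(‖p.1‖ ^ 2 + p.2 ^ 2))⁻¹) (y, t)) ∂μ := by
      refine lintegral_congr_ae ?_
      filter_upwards [compl_mem_ae_iff.2 (measure_singleton (μ := μ) (0 : U))] with y hy
      replace hy : y ≠ 0 := hy
      have hpdf' : Measurable fun p : ℝ × ℝ ↦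
          gaussianPDF 0 ((p.1⁻¹ * ‖y‖) ^ 2).toNNReal p.2 :=
        hpdf.comp (f := fun p : ℝ × ℝ ↦ (p.1, p.2, y)) (by fun_prop)
      have hind : Measurable fun t : ℝ ↦ S.indicator (1 : U × ℝ → ℝ≥0∞) (y, t) :=
        (measurable_one.indicator hS).comp (by fun_prop)
      calc
        _ = ∫⁻ s in Ioi (0 : ℝ), ∫⁻ t, ENNReal.ofReal (s⁻¹ * Real.exp (-s ^ 2 / 2)) *
              gaussianPDF 0 ((s⁻¹ * ‖y‖) ^ 2).toNNReal t * S.indicator 1 (y, t) := by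
          refine setLIntegral_congr_fun measurableSet_Ioi fun s hs ↦ ?_
          simp only [mul_assoc]
          rw [h2 y hy s hs, lintegral_const_mul]
          exact (measurable_gaussianPDF _ _).mul hind
        _ = ∫⁻ t, ∫⁻ s in Ioi (0 : ℝ), ENNReal.ofReal (s⁻¹ * Real.exp (-s ^ 2 / 2)) *
              gaussianPDF 0 ((s⁻¹ * ‖y‖) ^ 2).toNNReal t * S.indicator 1 (y, t) := by
          rw [lintegral_lintegral_swap]
          exact (((hw.comp measurable_fst).mul hpdf').mul
            (hind.comp measurable_snd)).aemeasurable
        _ = _ := by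
          refine lintegral_congr fun t ↦ ?_
          rw [lintegral_mul_const, lintegral_mul_gaussianPDF_inv (norm_pos_iff.2 hy)]
          · by_cases h : (y, t) ∈ S <;> simp [h]
          · exact hw.mul (hpdf'.comp (f := fun s : ℝ ↦ (s, t)) (by fun_prop))
    _ = _ := by
      rw [← lintegral_indicator hS, lintegral_prod]
      exact (Measurable.indicator (by fun_prop) hS).aemeasurable

lemma measure_diff_le_diff_of_measure_le {α : Type*} [MeasurableSpace α] {ν : Measure α}
    {A B : Set α} (hA : MeasurableSet A) (hB : MeasurableSet B) (hfin : ν A ≠ ∞)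
    (h : ν A ≤ ν B) : ν (A \ B) ≤ ν (B \ A) := by
  rw [← measure_inter_add_sdiff A hB, ← measure_inter_add_sdiff B hA, inter_comm B A] at h
  exact (ENNReal.add_le_add_iff_left
    (measure_ne_top_of_subset inter_subset_left hfin)).1 h

/-- If every section of `L` by the graph of a linear functional is at least as large as that of the
Euclidean unit ball of `U × ℝ`, then `L` is at least as large as that ball. -/
lemma measure_ball_le_of_graph_sections [Nontrivial U] {L : Set (U × ℝ)} (hL : MeasurableSet L)
    (h : ∀ a : U, μ {y | ‖y‖ ^ 2 + ⟪a, y⟫ ^ 2 ≤ 1} ≤ μ {y | (y, ⟪a, y⟫) ∈ L}) :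
    (μ.prod volume) {p : U × ℝ | ‖p.1‖ ^ 2 + p.2 ^ 2 ≤ 1} ≤ (μ.prod volume) L := by
  set D : Set (U × ℝ) := {p | ‖p.1‖ ^ 2 + p.2 ^ 2 ≤ 1}
  have hDm : MeasurableSet D := measurableSet_le (by fun_prop) (by fun_prop)
  have hsec (a : U) : μ {y | (y, ⟪a, y⟫) ∈ D \ L} ≤ μ {y | (y, ⟪a, y⟫) ∈ L \ D} := by
    have hgm : Measurable fun y : U ↦ (y, ⟪a, y⟫) := by fun_prop
    refine measure_diff_le_diff_of_measure_le (hgm hDm) (hgm hL) ?_ (h a)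
    have hfin : μ (closedBall 0 1) ≠ ∞ := (isCompact_closedBall (0 : U) 1).measure_lt_top.ne
    refine measure_ne_top_of_subset (fun y hy ↦ ?_) hfin
    replace hy : ‖y‖ ^ 2 + ⟪a, y⟫ ^ 2 ≤ 1 := hy
    rw [mem_closedBall_zero_iff]
    nlinarith [sq_nonneg ⟪a, y⟫, norm_nonneg y]
  have hint : ∫⁻ p in D \ L, ENNReal.ofReal (2 * √(‖p.1‖ ^ 2 + p.2 ^ 2))⁻¹ ∂(μ.prod volume) ≤
      ∫⁻ p in L \ D, ENNReal.ofReal (2 * √(‖p.1‖ ^ 2 + p.2 ^ 2))⁻¹ ∂(μ.prod volume) := by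
    rw [← lintegral_measure_graph_section μ (hDm.diff hL),
      ← lintegral_measure_graph_section μ (hL.diff hDm)]
    exact lintegral_mono fun s ↦ mul_le_mul_right (lintegral_mono fun a ↦ hsec _) _
  have hdiff : (μ.prod volume) (D \ L) ≤ (μ.prod volume) (L \ D) := by
    have hlow : ENNReal.ofReal 2⁻¹ * (μ.prod volume) (D \ L) ≤
        ∫⁻ p in D \ L, ENNReal.ofReal (2 * √(‖p.1‖ ^ 2 + p.2 ^ 2))⁻¹ ∂(μ.prod volume) := by
      rw [← setLIntegral_const]
      refine lintegral_mono_ae ?_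
      filter_upwards [ae_restrict_mem (hDm.diff hL),
        ae_restrict_of_ae (compl_mem_ae_iff.2 (measure_singleton (μ := μ.prod volume) 0))]
        with p hp hp0
      have hp1 : ‖p.1‖ ^ 2 + p.2 ^ 2 ≤ 1 := hp.1
      have hpos : 0 < ‖p.1‖ ^ 2 + p.2 ^ 2 := by
        by_contra! hle
        refine hp0 (Prod.ext ?_ ?_)
        · exact norm_eq_zero.1 (by nlinarith [sq_nonneg ‖p.1‖, sq_nonneg p.2])
        · exact pow_eq_zero_iff two_ne_zero |>.1 (by nlinarith [sq_nonneg ‖p.1‖, sq_nonneg p.2])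
      refine ENNReal.ofReal_le_ofReal (inv_anti₀ (by positivity) ?_)
      linarith [Real.sqrt_le_one.2 hp1]
    have hup : ∫⁻ p in L \ D, ENNReal.ofReal (2 * √(‖p.1‖ ^ 2 + p.2 ^ 2))⁻¹ ∂(μ.prod volume) ≤
        ENNReal.ofReal 2⁻¹ * (μ.prod volume) (L \ D) := by
      rw [← setLIntegral_const]
      refine setLIntegral_mono' (hL.diff hDm) fun p hp ↦ ?_
      have hp1 : 1 ≤ ‖p.1‖ ^ 2 + p.2 ^ 2 := (not_le.1 hp.2).le
      refine ENNReal.ofReal_le_ofReal (inv_anti₀ (by positivity) ?_)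
      linarith [Real.one_le_sqrt.2 hp1]
    exact (ENNReal.mul_le_mul_iff_right (by simp) (by simp)).1 (hlow.trans (hint.trans hup))
  rw [← measure_inter_add_sdiff D hL, ← measure_inter_add_sdiff L hDm, inter_comm L D]
  gcongr

end LinearSections

/-- The range of an injective linear map into a space of one more dimension is a hyperplane. -/
lemma exists_hyperplane_eq_range {n : ℕ} {U : Type*} [NormedAddCommGroup U]
    [InnerProductSpace ℝ U] [FiniteDimensional ℝ U] (hU : finrank ℝ U + 1 = n)
    (f : U →ₗ[ℝ] E n) (hf : Function.Injective f) :
    ∃ u ∈ sphere (0 : E n) 1, hyperplane u = range f := by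
  have hr : finrank ℝ (LinearMap.range f) = finrank ℝ U := LinearMap.finrank_range_of_inj hf
  have hn : finrank ℝ (E n) = n := by simp
  have ho : finrank ℝ (LinearMap.range f)ᗮ = 1 := by
    have := (LinearMap.range f).finrank_add_finrank_orthogonal
    omega
  obtain ⟨v, hv0, hv⟩ := finrank_eq_one_iff'.1 ho
  have hv0' : (v : E n) ≠ 0 := by simpa using hv0
  refine ⟨‖(v : E n)‖⁻¹ • (v : E n), by simp [norm_smul, hv0'], ?_⟩
  ext x
  have hx : x ∈ LinearMap.range f ↔ ⟪x, (v : E n)⟫ = 0 := by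
    rw [show x ∈ LinearMap.range f ↔ x ∈ (LinearMap.range f)ᗮᗮ by
      rw [Submodule.orthogonal_orthogonal], Submodule.mem_orthogonal']
    refine ⟨fun h ↦ h v v.2, fun h w hw ↦ ?_⟩
    obtain ⟨c, hc⟩ := hv ⟨w, hw⟩
    have : w = c • (v : E n) := by simpa using (congrArg Subtype.val hc).symm
    rw [this, real_inner_smul_right, h, mul_zero]
  have hx' : x ∈ range f ↔ x ∈ LinearMap.range f := by simp
  rw [hx', hx, hyperplane, mem_ofPred_eq, real_inner_smul_right]
  simp [hv0']

/-- Comparing hyperplane sections of `A` and `B` by Hausdorff measure is the same as comparing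
their preimages under injective linear maps. -/
lemma hausdorffMeasure_preimage_le_of_hyperplane_sections {n : ℕ} {U : Type*}
    [NormedAddCommGroup U] [InnerProductSpace ℝ U] [FiniteDimensional ℝ U] [MeasurableSpace U]
    [BorelSpace U] (hU : finrank ℝ U + 1 = n) {A B : Set (E n)}
    (hsec : ∀ u ∈ sphere (0 : E n) 1,
      μH[(n : ℝ) - 1] (A ∩ hyperplane u) ≤ μH[(n : ℝ) - 1] (B ∩ hyperplane u))
    (f : U →ₗ[ℝ] E n) (hf : Function.Injective f) :
    (μH[finrank ℝ U] : Measure U) (f ⁻¹' A) ≤ (μH[finrank ℝ U] : Measure U) (f ⁻¹' B) := by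
  obtain ⟨u, hu, hur⟩ := exists_hyperplane_eq_range hU f hf
  have h := hsec u hu
  have hn : (n : ℝ) - 1 = (finrank ℝ U : ℝ) := by rw [← hU]; push_cast; ring
  rw [hur, ← image_preimage_eq_inter_range, ← image_preimage_eq_inter_range, hn,
    f.hausdorffMeasure_image, f.hausdorffMeasure_image] at h
  have hd : f.normDet ≠ 0 := (f.normDet_ne_zero_tfae.out 0 1).2 (LinearMap.ker_eq_bot.2 hf)
  refine (ENNReal.mul_le_mul_iff_right ?_ ENNReal.ofReal_ne_top).1 h
  simpa using lt_of_le_of_ne f.normDet_nonneg hd.symm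

/-- (Busemann–Petty, via the Busemann intersection inequality.) The
Busemann–Petty problem has a positive answer when `K₁` is a centered ellipsoid,
i.e. the image of the closed unit ball under an invertible linear map. -/
theorem busemann_petty_ellipsoid (n : ℕ) (hn : 2 ≤ n) (K₁ K₂ : Set (E n))
    (hK₁ : ∃ T : E n ≃ₗ[ℝ] E n, K₁ = T '' closedBall (0 : E n) 1)
    (hK₂ : IsConvexBody K₂) (hc₂ : IsCentered K₂)
    (hsec : ∀ u ∈ sphere (0 : E n) 1,
      μH[(n : ℝ) - 1] (K₁ ∩ hyperplane u) ≤ μH[(n : ℝ) - 1] (K₂ ∩ hyperplane u)) :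
    μH[(n : ℝ)] K₁ ≤ μH[(n : ℝ)] K₂ := by
  obtain ⟨T, rfl⟩ := hK₁
  obtain ⟨m, rfl⟩ : ∃ m, n = m + 1 := ⟨n - 1, by omega⟩
  have : Nontrivial (E m) := by
    have : NeZero m := ⟨by omega⟩
    infer_instance
  have hfin : finrank ℝ (E m) + 1 = m + 1 := by simp
  let J : WithLp 2 (E m × ℝ) ≃ₗᵢ[ℝ] E (m + 1) :=
    ((stdOrthonormalBasis ℝ (WithLp 2 (E m × ℝ))).reindex (finCongr (by
      rw [(WithLp.linearEquiv 2 ℝ (E m × ℝ)).finrank_eq]; simp))).repr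
  let Q : (E m × ℝ) ≃L[ℝ] E (m + 1) :=
    ((WithLp.linearEquiv 2 ℝ (E m × ℝ)).symm.trans
      (J.toLinearEquiv.trans T)).toContinuousLinearEquiv
  have hball : Q ⁻¹' (T '' closedBall (0 : E (m + 1)) 1) =
      {p : E m × ℝ | ‖p.1‖ ^ 2 + p.2 ^ 2 ≤ 1} := by
    ext p
    have hQ : Q p = T (J (WithLp.toLp 2 p)) := rfl
    have hnorm : ‖WithLp.toLp 2 p‖ ^ 2 = ‖p.1‖ ^ 2 + p.2 ^ 2 := by
      rw [WithLp.prod_norm_sq_eq_of_L2]; simp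
    rw [mem_preimage, hQ, T.injective.mem_set_image, mem_closedBall_zero_iff, J.norm_map,
      mem_ofPred_eq, ← hnorm, sq_le_one_iff₀ (norm_nonneg _)]
  let μ : Measure (E m) := μH[finrank ℝ (E m)]
  let ν : Measure (E (m + 1)) := μH[finrank ℝ (E (m + 1))]
  have hν : ν = μH[((m + 1 : ℕ) : ℝ)] := by simp [ν]
  have hle : (μ.prod volume) (Q ⁻¹' (T '' closedBall 0 1)) ≤ (μ.prod volume) (Q ⁻¹' K₂) := by
    rw [hball]
    refine measure_ball_le_of_graph_sections μ
      (hK₂.1.measurableSet.preimage Q.continuous.measurable) fun a ↦ ?_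
    let f : E m →ₗ[ℝ] E (m + 1) :=
      Q.toLinearEquiv.toLinearMap ∘ₗ LinearMap.prod LinearMap.id (innerₛₗ ℝ a)
    have hf : Function.Injective f := fun x y hxy ↦
      congrArg Prod.fst (Q.injective hxy)
    have h := hausdorffMeasure_preimage_le_of_hyperplane_sections hfin hsec f hf
    have hpre : f ⁻¹' (T '' closedBall (0 : E (m + 1)) 1) =
        (fun y ↦ (y, ⟪a, y⟫)) ⁻¹' (Q ⁻¹' (T '' closedBall (0 : E (m + 1)) 1)) := rfl
    rw [hpre, hball] at h
    exact h
  have hmap : ((μ.prod volume).map Q).IsAddHaarMeasure := Q.isAddHaarMeasure_map _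
  have hscale := Measure.isAddLeftInvariant_eq_smul ((μ.prod volume).map Q) ν
  have happ (S : Set (E (m + 1))) : (μ.prod volume) (Q ⁻¹' S) =
      ((μ.prod volume).map Q) S :=
    (Q.toHomeomorph.toMeasurableEquiv.map_apply S).symm
  rw [happ, happ, hscale, Measure.smul_apply, Measure.smul_apply, ENNReal.smul_def,
    ENNReal.smul_def, smul_eq_mul, smul_eq_mul] at hle
  rw [← hν]
  refine (ENNReal.mul_le_mul_iff_right ?_ ENNReal.coe_ne_top).1 hle
  exact_mod_cast (Measure.addHaarScalarFactor_pos_of_isAddHaarMeasure _ _).ne'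
end
end

section
/- (Ball.) For every n ≥ 10 there exists r > 0 such that the centered unit cube Q = [−1/2, 1/2]ⁿ and the centered Euclidean ball B = {x ∈ ℝⁿ : |x| ≤ r} satisfy λ_{n−1}(Q ∩ u^⊥) ≤ λ_{n−1}(B ∩ u^⊥) for every u ∈ S^{n−1}, and yet λ_n(Q) > λ_n(B). Hence the Busemann–Petty problem has a negative answer in ℝⁿ for n ≥ 10. -/
open MeasureTheory Metric
open scoped RealInnerProductSpace ENNReal

noncomputable section

lemma sinc_le_exp {x : ℝ} (h0 : 0 < x) (hpi : x ≤ Real.pi) :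
    Real.sinc x ≤ Real.exp (-x ^ 2 / 6) := by
  have hx : x ≠ 0 := h0.ne'
  have hpi0 := Real.pi_pos
  set y := x / Real.pi with hy
  have hy0 : 0 < y := by positivity
  have hy1 : y ≤ 1 := by rw [hy, div_le_one hpi0]; exact hpi
  have hxy : Real.pi * y = x := by rw [hy]; field_simp
  have h1 := Real.tendsto_euler_sin_prod y
  have h2 : Filter.Tendsto (fun n : ℕ => Real.pi * y * Real.exp (-y ^ 2 *
      ∑ j ∈ Finset.range n, 1 / ((j : ℝ) + 1) ^ 2)) Filter.atTop
      (nhds (Real.pi * y * Real.exp (-y ^ 2 * (Real.pi ^ 2 / 6)))) := by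
    have h3 := hasSum_zeta_two
    rw [← hasSum_nat_add_iff' 1] at h3
    simp only [Finset.range_one, Finset.sum_singleton, Nat.cast_zero, ne_eq, OfNat.ofNat_ne_zero,
      not_false_eq_true, zero_pow, div_zero, sub_zero, Nat.cast_add, Nat.cast_one] at h3
    have h4 := h3.tendsto_sum_nat
    exact ((Real.continuous_exp.tendsto _).comp (h4.const_mul _)).const_mul _
  have h5 := le_of_tendsto_of_tendsto' h1 h2 (fun n => by
    rw [Finset.mul_sum, Real.exp_sum]
    refine mul_le_mul_of_nonneg_left (Finset.prod_le_prod (fun j _ => ?_) (fun j _ => ?_))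
      (by positivity)
    · rw [sub_nonneg, div_le_one (by positivity)]
      have : (0 : ℝ) ≤ j := by positivity
      nlinarith
    · have := Real.add_one_le_exp (-y ^ 2 * (1 / ((j : ℝ) + 1) ^ 2))
      refine le_trans (le_of_eq ?_) this
      ring)
  rw [hxy] at h5
  rw [Real.sinc_of_ne_zero hx, div_le_iff₀ h0, mul_comm]
  refine h5.trans (le_of_eq ?_)
  rw [hy]; congr 2; field_simp

lemma sin_le_quintic {x : ℝ} (hx : 0 ≤ x) : Real.sin x ≤ x - x ^ 3 / 6 + x ^ 5 / 120 := by
  have hsin : ∀ x : ℝ, 0 ≤ x → x - x ^ 3 / 6 ≤ Real.sin x := by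
    intro x hx
    have := monotoneOn_of_deriv_nonneg (f := fun x : ℝ => Real.sin x - (x - x ^ 3 / 6))
      (convex_Ici 0) (by fun_prop) (by fun_prop) (fun y hy => by
        have hd : HasDerivAt (fun x : ℝ => Real.sin x - (x - x ^ 3 / 6))
            (Real.cos y - (1 - (3 * y ^ 2) / 6)) y := by
          simpa using (Real.hasDerivAt_sin y).fun_sub ((hasDerivAt_id' y).fun_sub
            ((hasDerivAt_pow 3 y).div_const 6))
        rw [hd.deriv]
        have := Real.one_sub_sq_div_two_le_cos (x := y)
        linarith)
    have := this (Set.mem_Ici.2 le_rfl) (Set.mem_Ici.2 hx) hx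
    simp at this
    linarith
  have hcos : ∀ x : ℝ, 0 ≤ x → Real.cos x ≤ 1 - x ^ 2 / 2 + x ^ 4 / 24 := by
    intro x hx
    have := monotoneOn_of_deriv_nonneg (f := fun x : ℝ => (1 - x ^ 2 / 2 + x ^ 4 / 24) - Real.cos x)
      (convex_Ici 0) (by fun_prop) (by fun_prop) (fun y hy => by
        have hd : HasDerivAt (fun x : ℝ => (1 - x ^ 2 / 2 + x ^ 4 / 24) - Real.cos x)
            ((-((2 * y) / 2) + (4 * y ^ 3) / 24) - (- Real.sin y)) y := by
          simpa using ((((hasDerivAt_pow 2 y).div_const 2).const_sub 1).fun_add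
            ((hasDerivAt_pow 4 y).div_const 24)).fun_sub (Real.hasDerivAt_cos y)
        rw [hd.deriv]
        have := hsin y (by simpa using (interior_subset hy))
        linarith)
    have := this (Set.mem_Ici.2 le_rfl) (Set.mem_Ici.2 hx) hx
    simp at this
    linarith
  have := monotoneOn_of_deriv_nonneg (f := fun x : ℝ => (x - x ^ 3 / 6 + x ^ 5 / 120) - Real.sin x)
      (convex_Ici 0) (by fun_prop) (by fun_prop) (fun y hy => by
        have hd : HasDerivAt (fun x : ℝ => (x - x ^ 3 / 6 + x ^ 5 / 120) - Real.sin x)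
            ((1 - (3 * y ^ 2) / 6 + (5 * y ^ 4) / 120) - Real.cos y) y := by
          simpa using (((hasDerivAt_id' y).fun_sub ((hasDerivAt_pow 3 y).div_const 6)).fun_add
            ((hasDerivAt_pow 5 y).div_const 120)).fun_sub (Real.hasDerivAt_sin y)
        rw [hd.deriv]
        have := hcos y (by simpa using (interior_subset hy))
        linarith)
  have := this (Set.mem_Ici.2 le_rfl) (Set.mem_Ici.2 hx) hx
  simp at this
  linarith

/-- The integral of `|sin x / x| ^ p` over the real line. -/
def sincMoment (p : ℝ) : ℝ≥0∞ := ∫⁻ x : ℝ, ENNReal.ofReal |Real.sinc x| ^ p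

lemma measurable_ofReal_abs_sinc : Measurable fun x : ℝ => ENNReal.ofReal |Real.sinc x| :=
  (Real.continuous_sinc.abs.measurable).ennreal_ofReal

lemma sincMoment_eq_two_mul (p : ℝ) :
    sincMoment p = 2 * ∫⁻ x in Set.Ioi (0 : ℝ), ENNReal.ofReal |Real.sinc x| ^ p := by
  have hm : Measurable fun x : ℝ => ENNReal.ofReal |Real.sinc x| ^ p :=
    measurable_ofReal_abs_sinc.pow_const p
  have h : ∫⁻ x in Set.Iio (0 : ℝ), ENNReal.ofReal |Real.sinc x| ^ p =
      ∫⁻ x in Set.Ioi (0 : ℝ), ENNReal.ofReal |Real.sinc x| ^ p := by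
    have := (Measure.measurePreserving_neg (volume : Measure ℝ)).setLIntegral_comp_preimage
      (measurableSet_Ioi (a := (0 : ℝ))) hm
    simpa using this
  rw [sincMoment, ← lintegral_add_compl _ (measurableSet_Ioi (a := (0 : ℝ))), Set.compl_Ioi,
    setLIntegral_congr Iio_ae_eq_Iic.symm, h, two_mul]

lemma lintegral_sinc_tail_le {p : ℝ} (hp : 1 < p) :
    ∫⁻ x in Set.Ioi Real.pi, ENNReal.ofReal |Real.sinc x| ^ p ≤
      ENNReal.ofReal (Real.pi ^ (1 - p) / (p - 1)) := by
  have h1 := integral_Ioi_rpow_of_lt (a := -p) (by linarith) Real.pi_pos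
  have h2 := integrableOn_Ioi_rpow_of_lt (a := -p) (by linarith) Real.pi_pos
  have h3 : Real.pi ^ (1 - p) / (p - 1) = ∫ t in Set.Ioi Real.pi, t ^ (-p) := by
    rw [h1, show -p + 1 = -(p - 1) by ring, div_neg, neg_div, neg_neg]; ring_nf
  rw [h3, ofReal_integral_eq_lintegral_ofReal h2]
  · refine setLIntegral_mono' measurableSet_Ioi fun x hx => ?_
    have hx0 : 0 < x := Real.pi_pos.trans hx
    rw [ENNReal.ofReal_rpow_of_nonneg (abs_nonneg _) (by linarith)]
    refine ENNReal.ofReal_le_ofReal ?_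
    rw [Real.rpow_neg hx0.le, ← Real.inv_rpow hx0.le]
    refine Real.rpow_le_rpow (abs_nonneg _) ?_ (by linarith)
    rw [Real.sinc_of_ne_zero hx0.ne', abs_div, abs_of_pos hx0, inv_eq_one_div]
    gcongr
    exact Real.abs_sin_le_one x
  · filter_upwards [ae_restrict_mem measurableSet_Ioi] with x hx
    exact Real.rpow_nonneg (Real.pi_pos.trans hx).le _

lemma sincMoment_le_of_main {p a : ℝ} (hp : 1 < p) (ha : 0 ≤ a)
    (h : ∫⁻ x in Set.Ioc 0 Real.pi, ENNReal.ofReal |Real.sinc x| ^ p ≤ ENNReal.ofReal a) :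
    sincMoment p ≤ ENNReal.ofReal (2 * (a + Real.pi ^ (1 - p) / (p - 1))) := by
  have : (0:ℝ) ≤ Real.pi ^ (1 - p) / (p - 1) :=
    div_nonneg (Real.rpow_nonneg Real.pi_pos.le _) (by linarith)
  rw [sincMoment_eq_two_mul, ENNReal.ofReal_mul (by norm_num), ENNReal.ofReal_add ha this,
    ENNReal.ofReal_ofNat, ← Set.Ioc_union_Ioi_eq_Ioi Real.pi_pos.le]
  gcongr
  exact (lintegral_union_le _ _ _).trans (add_le_add h (lintegral_sinc_tail_le hp))

lemma sinc_nonneg_of_mem {x : ℝ} (hx : x ∈ Set.Ioc 0 Real.pi) : 0 ≤ Real.sinc x := by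
  rw [Real.sinc_of_ne_zero hx.1.ne']
  exact div_nonneg (Real.sin_nonneg_of_nonneg_of_le_pi hx.1.le hx.2) hx.1.le

lemma sincMoment_le_gaussian {p : ℝ} (hp : 1 < p) :
    sincMoment p ≤ ENNReal.ofReal (√(6 * Real.pi / p) + 2 * Real.pi ^ (1 - p) / (p - 1)) := by
  have hp0 : 0 < p := by linarith
  have := sincMoment_le_of_main (p := p) (a := √(Real.pi / (p / 6)) / 2) hp (by positivity) ?_
  · convert this using 2
    rw [show Real.pi / (p / 6) = 6 * Real.pi / p by field_simp]
    ring
  · rw [← integral_gaussian_Ioi, ofReal_integral_eq_lintegral_ofReal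
      (integrable_exp_neg_mul_sq (by positivity)).integrableOn
      (Filter.Eventually.of_forall fun x => (Real.exp_pos _).le)]
    refine (setLIntegral_mono' measurableSet_Ioc fun x hx => ?_).trans
      (lintegral_mono_set Set.Ioc_subset_Ioi_self)
    rw [ENNReal.ofReal_rpow_of_nonneg (abs_nonneg _) (by linarith)]
    refine ENNReal.ofReal_le_ofReal ?_
    rw [abs_of_nonneg (sinc_nonneg_of_mem hx)]
    refine (Real.rpow_le_rpow (sinc_nonneg_of_mem hx) (sinc_le_exp hx.1 hx.2) hp0.le).trans
      (le_of_eq ?_)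
    rw [← Real.exp_mul]; ring_nf

lemma sincMoment_three_le :
    sincMoment 3 ≤ ENNReal.ofReal (Real.pi * Real.exp (-(9 / 40))) := by
  have hpos : 0 ≤ ∫ x in (0:ℝ)..Real.pi, (1 - x ^ 2 / 6 + x ^ 4 / 120) ^ 3 := by
    refine intervalIntegral.integral_nonneg Real.pi_pos.le fun x _ => ?_
    have : (0:ℝ) ≤ 1 - x ^ 2 / 6 + x ^ 4 / 120 := by nlinarith [sq_nonneg (x ^ 2 - 10)]
    positivity
  have h := sincMoment_le_of_main (p := 3)
    (a := ∫ x in (0:ℝ)..Real.pi, (1 - x ^ 2 / 6 + x ^ 4 / 120) ^ 3) (by norm_num) hpos ?_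
  · refine h.trans (ENNReal.ofReal_le_ofReal ?_)
    have h1 : ∫ x in (0:ℝ)..Real.pi, (1 - x ^ 2 / 6 + x ^ 4 / 120) ^ 3 =
        Real.pi - Real.pi ^ 3 / 6 + 13 / 600 * Real.pi ^ 5 - 1 / 540 * Real.pi ^ 7
        + 13 / 129600 * Real.pi ^ 9 - 1 / 316800 * Real.pi ^ 11 + 1 / 22464000 * Real.pi ^ 13 := by
      have : ∀ x : ℝ, (1 - x ^ 2 / 6 + x ^ 4 / 120) ^ 3 = 1 - x ^ 2 * (1 / 2) + x ^ 4 * (13 / 120)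
          - x ^ 6 * (7 / 540) + x ^ 8 * (13 / 14400) - x ^ 10 * (1 / 28800)
          + x ^ 12 * (1 / 1728000) := fun x => by ring
      simp_rw [this]
      have hi : ∀ (k : ℕ) (c : ℝ), IntervalIntegrable (fun x : ℝ => x ^ k * c) volume 0 Real.pi :=
        fun k c => (by fun_prop : Continuous fun x : ℝ => x ^ k * c).intervalIntegrable _ _
      rw [intervalIntegral.integral_add, intervalIntegral.integral_sub,
        intervalIntegral.integral_add, intervalIntegral.integral_sub,
        intervalIntegral.integral_add, intervalIntegral.integral_sub]
      · simp only [intervalIntegral.integral_mul_const, integral_pow, intervalIntegral.integral_const]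
        norm_num
        ring
      all_goals exact Continuous.intervalIntegrable (by fun_prop) _ _
    have h2 : Real.pi ^ ((1:ℝ) - 3) = 1 / Real.pi ^ 2 := by
      rw [show (1:ℝ) - 3 = -(2:ℕ) by norm_num, Real.rpow_neg Real.pi_pos.le, Real.rpow_natCast,
        one_div]
    have h3 : (0.798 : ℝ) ≤ Real.exp (-(9 / 40)) := by
      have := Real.exp_bound' (x := 9 / 40) (n := 4) (by norm_num) (by norm_num) (by norm_num)
      rw [Real.exp_neg, le_inv_comm₀ (by norm_num) (Real.exp_pos _)]
      refine this.trans ?_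
      norm_num [Finset.sum_range_succ, Nat.factorial]
    have l := Real.pi_gt_d6
    have u := Real.pi_lt_d6
    have hinv : 1 / Real.pi ^ 2 ≤ 1 / 3.141592 ^ 2 := by gcongr
    have p3 : 3.141592 ^ 3 ≤ Real.pi ^ 3 := by gcongr
    have p5 : Real.pi ^ 5 ≤ 3.141593 ^ 5 := by gcongr
    have p7 : 3.141592 ^ 7 ≤ Real.pi ^ 7 := by gcongr
    have p9 : Real.pi ^ 9 ≤ 3.141593 ^ 9 := by gcongr
    have p11 : 3.141592 ^ 11 ≤ Real.pi ^ 11 := by gcongr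
    have p13 : Real.pi ^ 13 ≤ 3.141593 ^ 13 := by gcongr
    have hm : 3.141592 * 0.798 ≤ Real.pi * Real.exp (-(9 / 40)) := by gcongr
    rw [h1, h2]
    norm_num at *
    linarith
  · rw [intervalIntegral.integral_of_le Real.pi_pos.le, ofReal_integral_eq_lintegral_ofReal]
    · refine setLIntegral_mono' measurableSet_Ioc fun x hx => ?_
      rw [ENNReal.ofReal_rpow_of_nonneg (abs_nonneg _) (by norm_num)]
      refine ENNReal.ofReal_le_ofReal ?_
      rw [abs_of_nonneg (sinc_nonneg_of_mem hx)]
      norm_cast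
      refine pow_le_pow_left₀ (sinc_nonneg_of_mem hx) ?_ 3
      rw [Real.sinc_of_ne_zero hx.1.ne', div_le_iff₀ hx.1]
      refine (sin_le_quintic hx.1.le).trans (le_of_eq (by ring))
    · exact (Continuous.integrableOn_Icc (by fun_prop)).mono_set Set.Ioc_subset_Icc_self
    · refine Filter.Eventually.of_forall fun x => ?_
      have : (0:ℝ) ≤ 1 - x ^ 2 / 6 + x ^ 4 / 120 := by nlinarith [sq_nonneg (x ^ 2 - 10)]
      simp only [Pi.zero_apply]
      positivity

open ProbabilityTheory in
lemma lintegral_gaussianPDF_affine {v : NNReal} (hv : v ≠ 0) {a : ℝ} (ha : a ≠ 0) (c : ℝ) :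
    ∫⁻ x, gaussianPDF 0 v (a * x + c) = ENNReal.ofReal |a|⁻¹ := by
  have h : ∀ x, gaussianPDF 0 v (a * x + c) = ENNReal.ofReal |a|⁻¹ *
      gaussianPDF (a⁻¹ * (0 - c)) (.mk (a ^ 2)⁻¹ (inv_nonneg.mpr (sq_nonneg _)) * v) x := by
    intro x
    rw [gaussianPDF, gaussianPDFReal_add, gaussianPDFReal_mul ha, ENNReal.ofReal_mul (abs_nonneg _),
      abs_inv]
    rfl
  simp_rw [h]
  rw [lintegral_const_mul _ (measurable_gaussianPDF _ _), lintegral_gaussianPDF_eq_one, mul_one]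
  refine mul_ne_zero (fun h => ?_) hv
  have h' := congrArg NNReal.toReal h
  simp [ha] at h'

/-- The uniform probability measure on the cube `[-1/2, 1/2] ^ n`. -/
def cubeMeasure (n : ℕ) : Measure (Fin n → ℝ) :=
  Measure.pi fun _ => volume.restrict (Set.Icc (-(1 / 2)) (1 / 2))

instance isProbabilityMeasure_restrict_unit :
    IsProbabilityMeasure ((volume : Measure ℝ).restrict (Set.Icc (-(1 / 2)) (1 / 2))) :=
  ⟨by rw [Measure.restrict_apply_univ, Real.volume_Icc]; norm_num⟩

instance (n : ℕ) : IsProbabilityMeasure (cubeMeasure n) := by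
  unfold cubeMeasure; infer_instance

/-- The mean over the cube of a Gaussian density in the direction `u`. -/
def cubeGaussian {n : ℕ} (v : NNReal) (u : Fin n → ℝ) : ℝ≥0∞ :=
  ∫⁻ x, ProbabilityTheory.gaussianPDF 0 v (∑ i, u i * x i) ∂cubeMeasure n

lemma cubeGaussian_le_inv {m : ℕ} {v : NNReal} (hv : v ≠ 0) (u : Fin (m + 1) → ℝ)
    (i : Fin (m + 1)) (hi : u i ≠ 0) : cubeGaussian v u ≤ ENNReal.ofReal |u i|⁻¹ := by
  have hmp := measurePreserving_piFinSuccAbove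
    (fun _ : Fin (m + 1) => (volume : Measure ℝ).restrict (Set.Icc (-(1 / 2)) (1 / 2))) i
  have hmeas : Measurable fun p : ℝ × (Fin m → ℝ) =>
      ProbabilityTheory.gaussianPDF 0 v (u i * p.1 + ∑ j, u (i.succAbove j) * p.2 j) :=
    (ProbabilityTheory.measurable_gaussianPDF 0 v).comp (by fun_prop)
  have h := hmp.lintegral_comp hmeas
  have hrw : cubeGaussian v u = ∫⁻ p : ℝ × (Fin m → ℝ),
      ProbabilityTheory.gaussianPDF 0 v (u i * p.1 + ∑ j, u (i.succAbove j) * p.2 j)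
      ∂(((volume : Measure ℝ).restrict (Set.Icc (-(1 / 2)) (1 / 2))).prod (cubeMeasure m)) := by
    rw [cubeMeasure, ← h, cubeGaussian, cubeMeasure]
    refine lintegral_congr fun x => ?_
    rw [Fin.sum_univ_succAbove _ i]
    rfl
  rw [hrw, lintegral_prod_symm _ hmeas.aemeasurable]
  calc _ ≤ ∫⁻ _ : Fin m → ℝ, ENNReal.ofReal |u i|⁻¹ ∂cubeMeasure m := by
        refine lintegral_mono fun y => ?_
        rw [← lintegral_gaussianPDF_affine hv hi (∑ j, u (i.succAbove j) * y j)]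
        exact lintegral_mono' Measure.restrict_le_self le_rfl
    _ = _ := by simp

lemma integral_exp_mul_I_unit (a : ℝ) :
    ∫ x : ℝ in Set.Icc (-(1 / 2)) (1 / 2), Complex.exp (Complex.I * a * x) =
      (Real.sinc (a / 2) : ℂ) := by
  rw [integral_Icc_eq_integral_Ioc, ← intervalIntegral.integral_of_le (by norm_num)]
  rcases eq_or_ne a 0 with rfl | ha
  · norm_num
  have h := integral_exp_mul_I_eq_sinc (a / 2)
  have h2 := intervalIntegral.integral_comp_mul_left (a := -(1 / 2)) (b := 1 / 2)
    (fun t : ℝ => Complex.exp (t * Complex.I)) ha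
  rw [show a * -(1 / 2) = -(a / 2) by ring, show a * (1 / 2) = a / 2 by ring, h] at h2
  have ha' : (a : ℂ) ≠ 0 := by exact_mod_cast ha
  calc _ = ∫ x : ℝ in (-(1 / 2))..(1 / 2), Complex.exp ((a * x : ℝ) * Complex.I) := by
        congr 1; ext x; push_cast; ring_nf
    _ = _ := by
        rw [h2, Complex.real_smul]; push_cast; field_simp

lemma gaussianPDFReal_eq_integral {v : NNReal} (hv : v ≠ 0) (t : ℝ) :
    ((ProbabilityTheory.gaussianPDFReal 0 v t : ℝ) : ℂ) =
      (2 * Real.pi : ℂ)⁻¹ * ∫ s : ℝ, Complex.exp (Complex.I * t * s) *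
        Complex.exp (-(v / 2 : ℝ) * s ^ 2) := by
  have hv0 : (0 : ℝ) < v := by positivity
  rw [fourierIntegral_gaussian (b := ((v / 2 : ℝ) : ℂ)) (by simpa using hv0) (t : ℂ)]
  have h1 : ((Real.pi : ℂ) / ((v / 2 : ℝ) : ℂ)) ^ (1 / 2 : ℂ) = ((√(Real.pi / (v / 2)) : ℝ) : ℂ) := by
    rw [Real.sqrt_eq_rpow, Complex.ofReal_cpow (by positivity)]
    push_cast; rfl
  rw [h1]
  have h2 : Complex.exp (-(t : ℂ) ^ 2 / (4 * ((v / 2 : ℝ) : ℂ))) =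
      ((Real.exp (-t ^ 2 / (2 * v)) : ℝ) : ℂ) := by
    push_cast; congr 2; ring
  rw [h2, ProbabilityTheory.gaussianPDFReal]
  norm_cast
  rw [← mul_assoc]
  congr 1
  · rw [show ((v / 2 : NNReal) : ℝ) = (v : ℝ) / 2 by simp,
      show Real.pi / ((v : ℝ) / 2) = (2 * Real.pi) ^ 2 / (2 * Real.pi * v) by field_simp,
      Real.sqrt_div (by positivity), Real.sqrt_sq (by positivity)]
    field_simp
  · simp

lemma cubeGaussian_eq {n : ℕ} {v : NNReal} (hv : v ≠ 0) (u : Fin n → ℝ) :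
    cubeGaussian v u = ENNReal.ofReal ((2 * Real.pi)⁻¹ *
      ∫ s : ℝ, Real.exp (-(v / 2) * s ^ 2) * ∏ i, Real.sinc (s * u i / 2)) := by
  have hv0 : (0 : ℝ) < v := by positivity
  have hgauss_int : Integrable (fun s : ℝ => Real.exp (-(v / 2 : ℝ) * s ^ 2)) :=
    integrable_exp_neg_mul_sq (by positivity)
  have hcont : Continuous fun x : Fin n → ℝ =>
      ProbabilityTheory.gaussianPDFReal 0 v (∑ i, u i * x i) := by
    unfold ProbabilityTheory.gaussianPDFReal; fun_prop
  have hbd : ∀ t, ProbabilityTheory.gaussianPDFReal 0 v t ≤ (√(2 * Real.pi * v))⁻¹ := by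
    intro t
    rw [ProbabilityTheory.gaussianPDFReal]
    refine mul_le_of_le_one_right (by positivity) (Real.exp_le_one_iff.2 ?_)
    rw [neg_div, neg_nonpos]; positivity
  have hint2 : Integrable (fun x : Fin n → ℝ =>
      ProbabilityTheory.gaussianPDFReal 0 v (∑ i, u i * x i)) (cubeMeasure n) := by
    refine Integrable.of_bound hcont.aestronglyMeasurable (√(2 * Real.pi * v))⁻¹ (ae_of_all _ fun x => ?_)
    rw [Real.norm_of_nonneg (ProbabilityTheory.gaussianPDFReal_nonneg _ _ _)]
    exact hbd _
  unfold cubeGaussian ProbabilityTheory.gaussianPDF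
  rw [← ofReal_integral_eq_lintegral_ofReal hint2
    (ae_of_all _ fun x => ProbabilityTheory.gaussianPDFReal_nonneg _ _ _)]
  congr 1
  have hgoal : ((∫ x, ProbabilityTheory.gaussianPDFReal 0 v (∑ i, u i * x i) ∂cubeMeasure n : ℝ) : ℂ)
      = (((2 * Real.pi)⁻¹ *
      ∫ s : ℝ, Real.exp (-(v / 2) * s ^ 2) * ∏ i, Real.sinc (s * u i / 2) : ℝ) : ℂ) := by
    rw [← integral_complex_ofReal]
    simp_rw [gaussianPDFReal_eq_integral hv]
    rw [integral_const_mul, integral_integral_swap]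
    · rw [Complex.ofReal_mul, ← integral_complex_ofReal]
      push_cast
      congr 1
      refine integral_congr_ae (ae_of_all _ fun s => ?_)
      simp only
      rw [integral_mul_const, mul_comm]
      congr 1
      have : ∀ x : Fin n → ℝ, Complex.exp (Complex.I * (∑ i, (u i : ℂ) * (x i : ℂ)) * s) =
          ∏ i, Complex.exp (Complex.I * ((s * u i : ℝ) : ℂ) * (x i : ℂ)) := by
        intro x
        rw [← Complex.exp_sum, Finset.mul_sum, Finset.sum_mul]
        congr 1
        refine Finset.sum_congr rfl fun i _ => ?_
        push_cast; ring
      simp_rw [this]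
      rw [cubeMeasure, integral_fintype_prod_eq_prod
        (fun (i : Fin n) (y : ℝ) => Complex.exp (Complex.I * ((s * u i : ℝ) : ℂ) * (y : ℂ)))]
      simp_rw [integral_exp_mul_I_unit]
    · have h1 : Integrable (fun z : (Fin n → ℝ) × ℝ => Real.exp (-(v / 2 : ℝ) * z.2 ^ 2))
          ((cubeMeasure n).prod volume) := hgauss_int.comp_snd _
      refine h1.mono (Continuous.aestronglyMeasurable (by unfold Function.uncurry; fun_prop))
        (ae_of_all _ fun z => ?_)
      simp only [Function.uncurry, norm_mul, Complex.norm_exp]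
      rw [Real.norm_of_nonneg (Real.exp_pos _).le]
      refine le_of_eq ?_
      rw [← Real.exp_add]
      congr 1
      simp [← Complex.ofReal_pow, Complex.mul_re]
  exact_mod_cast hgoal

lemma cubeGaussian_le_lintegral {n : ℕ} {v : NNReal} (hv : v ≠ 0) (u : Fin n → ℝ) :
    cubeGaussian v u ≤ ENNReal.ofReal (2 * Real.pi)⁻¹ *
      ∫⁻ s : ℝ, ∏ i, ENNReal.ofReal |Real.sinc (s * u i / 2)| := by
  rw [cubeGaussian_eq hv, ENNReal.ofReal_mul (by positivity)]
  gcongr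
  refine (ENNReal.ofReal_le_ofReal (le_abs_self _)).trans ?_
  rw [← Real.norm_eq_abs, ofReal_norm]
  refine (enorm_integral_le_lintegral_enorm _).trans (lintegral_mono fun s => ?_)
  rw [← ofReal_norm, Real.norm_eq_abs, abs_mul, Finset.abs_prod,
    ← ENNReal.ofReal_prod_of_nonneg (fun i _ => abs_nonneg _)]
  refine ENNReal.ofReal_le_ofReal (mul_le_of_le_one_left (by positivity) ?_)
  rw [abs_of_pos (Real.exp_pos _), Real.exp_le_one_iff]
  have : (0 : ℝ) ≤ v := v.2
  nlinarith [mul_nonneg this (sq_nonneg s)]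

lemma lintegral_comp_mul_right {g : ℝ → ℝ≥0∞} (hg : Measurable g) {a : ℝ} (ha : a ≠ 0) :
    ∫⁻ s, g (s * a) = ENNReal.ofReal |a|⁻¹ * ∫⁻ s, g s := by
  rw [← abs_inv, ← smul_eq_mul, ← lintegral_smul_measure, ← Real.map_volume_mul_right ha,
    lintegral_map hg (by fun_prop)]

lemma sincMoment_two_le : sincMoment 2 ≤ ENNReal.ofReal Real.pi := by
  have hbound : ∀ k : ℕ, ∫⁻ s : ℝ, ENNReal.ofReal (Real.exp (-((1 / (k + 1)) / 2) * s ^ 2) *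
      Real.sinc (s * (1 / 2)) ^ 2) ≤ ENNReal.ofReal (2 * Real.pi) := by
    intro k
    set v : NNReal := 1 / (k + 1) with hvdef
    have hv : v ≠ 0 := by positivity
    have hvr : (1 / (k + 1) : ℝ) = v := by simp [hvdef]
    have hv0 : (0 : ℝ) < v := by positivity
    have h1 := cubeGaussian_le_inv hv (fun _ : Fin 2 => (1 : ℝ)) 0 one_ne_zero
    rw [cubeGaussian_eq hv] at h1
    simp only [mul_one, abs_one, inv_one] at h1
    have h2 := (ENNReal.ofReal_le_ofReal_iff zero_le_one).1 h1
    rw [inv_mul_le_iff₀ (by positivity), mul_one] at h2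
    rw [hvr, ← ofReal_integral_eq_lintegral_ofReal]
    · refine ENNReal.ofReal_le_ofReal ?_
      simpa only [mul_one_div, Finset.prod_const, Finset.card_univ, Fintype.card_fin] using h2
    · refine (integrable_exp_neg_mul_sq (b := (v : ℝ) / 2) (by positivity)).mono
        (Continuous.aestronglyMeasurable ?_) (ae_of_all _ fun s => ?_)
      · exact (by fun_prop : Continuous fun s : ℝ => Real.exp (-((v : ℝ) / 2) * s ^ 2)).mul
          ((Real.continuous_sinc.comp (by fun_prop)).pow 2)
      · rw [norm_mul]
        refine mul_le_of_le_one_right (norm_nonneg _) ?_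
        rw [norm_pow, Real.norm_eq_abs]
        exact pow_le_one₀ (abs_nonneg _) (Real.abs_sinc_le_one _)
    · exact ae_of_all _ fun s => by positivity
  have hlim : ∫⁻ s : ℝ, ENNReal.ofReal |Real.sinc (s * (1 / 2))| ^ (2 : ℝ) ≤
      ENNReal.ofReal (2 * Real.pi) := by
    have hfatou := lintegral_liminf_le (μ := (volume : Measure ℝ)) (u := Filter.atTop)
      (f := fun (k : ℕ) (s : ℝ) => ENNReal.ofReal (Real.exp (-((1 / (k + 1)) / 2) * s ^ 2) *
        Real.sinc (s * (1 / 2)) ^ 2)) (fun k => Measurable.ennreal_ofReal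
        ((by fun_prop : Measurable fun s : ℝ => Real.exp (-((1 / ((k : ℝ) + 1)) / 2) * s ^ 2)).mul
          ((Real.measurable_sinc.comp (by fun_prop)).pow_const 2)))
    refine (le_of_eq ?_).trans (hfatou.trans ((Filter.liminf_le_liminf
      (Filter.Eventually.of_forall hbound)).trans (by simp)))
    refine lintegral_congr fun s => ?_
    have ht : Filter.Tendsto (fun k : ℕ => ENNReal.ofReal
        (Real.exp (-((1 / ((k : ℝ) + 1)) / 2) * s ^ 2) * Real.sinc (s * (1 / 2)) ^ 2))
        Filter.atTop (nhds (ENNReal.ofReal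
        (Real.exp (-(0 / 2) * s ^ 2) * Real.sinc (s * (1 / 2)) ^ 2))) := by
      refine ENNReal.tendsto_ofReal (Filter.Tendsto.mul_const _ ?_)
      exact (Real.continuous_exp.tendsto _).comp
        (((tendsto_one_div_add_atTop_nhds_zero_nat.div_const 2).neg).mul_const _)
    rw [ht.liminf_eq, ENNReal.ofReal_rpow_of_nonneg (abs_nonneg _) (by norm_num)]
    simp
  have hm : Measurable fun x : ℝ => ENNReal.ofReal |Real.sinc x| ^ (2 : ℝ) :=
    measurable_ofReal_abs_sinc.pow_const 2
  rw [lintegral_comp_mul_right hm (a := 1 / 2) (by norm_num)] at hlim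
  have h2 : ENNReal.ofReal |(1 / 2 : ℝ)|⁻¹ = 2 := by
    rw [abs_of_pos (by norm_num)]; norm_num
  rw [h2, ENNReal.ofReal_mul (by norm_num), ENNReal.ofReal_ofNat] at hlim
  exact (ENNReal.mul_le_mul_iff_right (by norm_num) (by norm_num)).1 hlim

lemma sincMoment_interpolate {a b α β t : ℝ} (ht0 : 0 ≤ t) (ht1 : t ≤ 1)
    (ha : sincMoment a ≤ ENNReal.ofReal (Real.pi * Real.exp (-α)))
    (hb : sincMoment b ≤ ENNReal.ofReal (Real.pi * Real.exp (-β)))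
    (ha0 : 0 ≤ a) (hb0 : 0 ≤ b) :
    sincMoment ((1 - t) * a + t * b) ≤
      ENNReal.ofReal (Real.pi * Real.exp (-((1 - t) * α + t * β))) := by
  have hm := fun p : ℝ => measurable_ofReal_abs_sinc.pow_const p
  have h := ENNReal.lintegral_mul_norm_pow_le (μ := (volume : Measure ℝ)) (hm a).aemeasurable
    (hm b).aemeasurable (p := 1 - t) (q := t) (by linarith) ht0 (by ring)
  have heq : sincMoment ((1 - t) * a + t * b) = ∫⁻ x : ℝ,
      (ENNReal.ofReal |Real.sinc x| ^ a) ^ (1 - t) * (ENNReal.ofReal |Real.sinc x| ^ b) ^ t := by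
    refine lintegral_congr fun x => ?_
    rw [← ENNReal.rpow_mul, ← ENNReal.rpow_mul, mul_comm a, mul_comm b,
      ENNReal.rpow_add_of_nonneg _ _ (mul_nonneg (by linarith) ha0) (mul_nonneg ht0 hb0)]
  rw [heq]
  refine h.trans ?_
  have h1t : 0 ≤ 1 - t := by linarith
  refine (mul_le_mul' (ENNReal.rpow_le_rpow ha h1t) (ENNReal.rpow_le_rpow hb ht0)).trans
    (le_of_eq ?_)
  rw [ENNReal.ofReal_rpow_of_nonneg (by positivity) h1t,
    ENNReal.ofReal_rpow_of_nonneg (by positivity) ht0, ← ENNReal.ofReal_mul (by positivity)]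
  congr 1
  rw [Real.mul_rpow Real.pi_pos.le (Real.exp_pos _).le,
    Real.mul_rpow Real.pi_pos.le (Real.exp_pos _).le, mul_mul_mul_comm,
    ← Real.rpow_add Real.pi_pos, ← Real.exp_mul, ← Real.exp_mul, ← Real.exp_add]
  rw [show 1 - t + t = 1 by ring, Real.rpow_one]
  ring_nf

lemma exp_neg_le_sqrt_div {p x N : ℝ} (hp : 0 < p) (h : p * Real.exp (-(2 * x)) ≤ N) :
    Real.exp (-x) ≤ √(N / p) := by
  refine Real.le_sqrt_of_sq_le ?_
  rw [le_div_iff₀ hp, ← Real.exp_nat_mul]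
  refine le_trans (le_of_eq ?_) h
  push_cast; ring_nf

lemma mul_exp_neg_le {p k c : ℝ} (hk : 0 < k) :
    p * Real.exp (-(k * p + c)) ≤ Real.exp (-(1 + c)) / k := by
  have h := Real.add_one_le_exp (k * p - 1)
  rw [le_div_iff₀ hk]
  calc _ = (k * p - 1 + 1) * Real.exp (-(k * p + c)) := by ring
    _ ≤ Real.exp (k * p - 1) * Real.exp (-(k * p + c)) := by gcongr
    _ = _ := by rw [← Real.exp_add]; ring_nf

lemma sincMoment_gaussian_le {p : ℝ} (hp : 4 ≤ p) {δ : ℝ} (hδ : √(6 / Real.pi) + 0.014 ≤ δ) :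
    sincMoment p ≤ ENNReal.ofReal (Real.pi * (δ / √p)) := by
  have hπ := Real.pi_gt_d6
  have hsp : 2 ≤ √p := Real.le_sqrt_of_sq_le (by linarith)
  have hsq : √p ^ 2 = p := Real.sq_sqrt (by linarith)
  refine (sincMoment_le_gaussian (by linarith)).trans (ENNReal.ofReal_le_ofReal ?_)
  have h1 : √(6 * Real.pi / p) = Real.pi * (√(6 / Real.pi) / √p) := by
    rw [show 6 * Real.pi / p = Real.pi ^ 2 * ((6 / Real.pi) / p) by field_simp,
      Real.sqrt_mul (by positivity), Real.sqrt_sq Real.pi_pos.le, Real.sqrt_div (by positivity)]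
  have h2 : 2 * Real.pi ^ (1 - p) / (p - 1) ≤ Real.pi * (0.014 / √p) := by
    have h3 : Real.pi ^ (1 - p) ≤ Real.pi * (1 / 97) := by
      have : Real.pi ^ (1 - p) ≤ Real.pi ^ ((1 : ℝ) - 4) :=
        Real.rpow_le_rpow_of_exponent_le (by linarith) (by linarith)
      refine this.trans ?_
      rw [sub_eq_add_neg, Real.rpow_add Real.pi_pos, Real.rpow_one, Real.rpow_neg Real.pi_pos.le]
      gcongr
      rw [one_div]
      gcongr
      norm_cast
      calc (97 : ℝ) ≤ 3.141592 ^ 4 := by norm_num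
        _ ≤ _ := by gcongr
    rw [div_le_iff₀ (by linarith)]
    have h4 : (2 / 97 : ℝ) ≤ (0.014 / √p) * (p - 1) := by
      rw [div_mul_eq_mul_div, le_div_iff₀ (by linarith)]
      nlinarith
    nlinarith
  rw [h1]
  calc _ ≤ Real.pi * (√(6 / Real.pi) / √p) + Real.pi * (0.014 / √p) := by gcongr
    _ = Real.pi * ((√(6 / Real.pi) + 0.014) / √p) := by ring
    _ ≤ _ := by gcongr

lemma sqrt_six_div_pi_le : √(6 / Real.pi) ≤ 1.382 := by
  have hπ := Real.pi_gt_d6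
  refine Real.sqrt_le_iff.2 ⟨by norm_num, ?_⟩
  rw [div_le_iff₀ Real.pi_pos]
  nlinarith

lemma sincMoment_four_le : sincMoment 4 ≤ ENNReal.ofReal (Real.pi * Real.exp (-(7 / 20))) := by
  refine (sincMoment_gaussian_le le_rfl (δ := 1.396)
    (by linarith [sqrt_six_div_pi_le])).trans (ENNReal.ofReal_le_ofReal ?_)
  have h4 : √(4 : ℝ) = 2 := by
    rw [show (4 : ℝ) = 2 ^ 2 by norm_num]; exact Real.sqrt_sq (by norm_num)
  rw [h4]
  gcongr
  have := Real.exp_bound' (x := 7 / 20) (n := 4) (by norm_num) (by norm_num) (by norm_num)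
  rw [Real.exp_neg, le_inv_comm₀ (by norm_num) (Real.exp_pos _)]
  refine this.trans ?_
  norm_num [Finset.sum_range_succ, Nat.factorial]

/-- A version of Ball's integral inequality, with a slightly weaker constant. -/
lemma sincMoment_le {p : ℝ} (hp : 2 ≤ p) :
    sincMoment p ≤ ENNReal.ofReal (Real.pi * √((1007 / 500) / p)) := by
  have hp0 : 0 < p := by linarith
  rcases le_total p 3 with h3 | h3
  · have h := sincMoment_interpolate (a := 2) (b := 3) (α := 0) (β := 9 / 40) (t := p - 2)
      (by linarith) (by linarith) (by simpa using sincMoment_two_le) sincMoment_three_le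
      (by norm_num) (by norm_num)
    rw [show (1 - (p - 2)) * 2 + (p - 2) * 3 = p by ring] at h
    refine h.trans (ENNReal.ofReal_le_ofReal ?_)
    gcongr
    refine exp_neg_le_sqrt_div hp0 ?_
    have := mul_exp_neg_le (p := p) (k := 9 / 20) (c := -(9 / 10)) (by norm_num)
    rw [show 2 * ((1 - (p - 2)) * 0 + (p - 2) * (9 / 40)) = 9 / 20 * p + -(9 / 10) by ring]
    refine this.trans ?_
    have he := Real.quadratic_le_exp_of_nonneg (x := 1 / 10) (by norm_num)
    rw [show -(1 + -(9 / 10 : ℝ)) = -(1 / 10) by norm_num, Real.exp_neg, div_le_iff₀ (by norm_num)]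
    refine (inv_anti₀ (by norm_num) he).trans ?_
    norm_num
  rcases le_total p 4 with h4 | h4
  · have h := sincMoment_interpolate (a := 3) (b := 4) (α := 9 / 40) (β := 7 / 20) (t := p - 3)
      (by linarith) (by linarith) sincMoment_three_le sincMoment_four_le
      (by norm_num) (by norm_num)
    rw [show (1 - (p - 3)) * 3 + (p - 3) * 4 = p by ring] at h
    refine h.trans (ENNReal.ofReal_le_ofReal ?_)
    gcongr
    refine exp_neg_le_sqrt_div hp0 ?_
    have := mul_exp_neg_le (p := p) (k := 1 / 4) (c := -(3 / 10)) (by norm_num)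
    rw [show 2 * ((1 - (p - 3)) * (9 / 40) + (p - 3) * (7 / 20)) = 1 / 4 * p + -(3 / 10) by ring]
    refine this.trans ?_
    have he := Real.sum_le_exp_of_nonneg (x := 7 / 10) (by norm_num) 4
    rw [show -(1 + -(3 / 10 : ℝ)) = -(7 / 10) by norm_num, Real.exp_neg, div_le_iff₀ (by norm_num)]
    refine (inv_anti₀ (by norm_num [Finset.sum_range_succ]) he).trans ?_
    norm_num [Finset.sum_range_succ, Nat.factorial]
  · refine (sincMoment_gaussian_le h4 (δ := √(1007 / 500)) ?_).trans ?_
    · have : (1.396 : ℝ) ≤ √(1007 / 500) := Real.le_sqrt_of_sq_le (by norm_num)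
      linarith [sqrt_six_div_pi_le]
    · rw [Real.sqrt_div (by norm_num : (0 : ℝ) ≤ 1007 / 500) p]

lemma cubeGaussian_le {m : ℕ} {v : NNReal} (hv : v ≠ 0) (u : Fin (m + 1) → ℝ)
    (hu : ∑ i, u i ^ 2 = 1) : cubeGaussian v u ≤ ENNReal.ofReal √(1007 / 500) := by
  by_cases hbig : ∃ i, 1 / 2 < u i ^ 2
  · obtain ⟨i, hi⟩ := hbig
    have hi0 : u i ≠ 0 := by rintro h; norm_num [h] at hi
    refine (cubeGaussian_le_inv hv u i hi0).trans (ENNReal.ofReal_le_ofReal ?_)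
    refine Real.le_sqrt_of_sq_le ?_
    rw [inv_pow, sq_abs, inv_le_comm₀ (by positivity) (by norm_num)]
    linarith [show (1007 / 500 : ℝ)⁻¹ ≤ 1 / 2 by norm_num]
  push Not at hbig
  set S := Finset.univ.filter fun i => u i ≠ 0 with hS
  have hSne : ∀ i ∈ S, u i ≠ 0 := fun i hi => (Finset.mem_filter.1 hi).2
  have hsum : ∑ i ∈ S, u i ^ 2 = 1 := by
    rw [← hu, hS, Finset.sum_filter_of_ne]
    intro i _ h h0
    simp [h0] at h
  have hM : 0 < 2 * Real.pi * √(1007 / 500) := by positivity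
  have hpow : ∀ p : ℝ, Measurable fun x : ℝ => ENNReal.ofReal |Real.sinc x| ^ p := fun p =>
    measurable_ofReal_abs_sinc.pow_const p
  have hmeas : ∀ i, Measurable fun s : ℝ =>
      ENNReal.ofReal |Real.sinc (s * u i / 2)| ^ (1 / u i ^ 2) := fun i =>
    (hpow _).comp (by fun_prop : Measurable fun s : ℝ => s * u i / 2)
  have hfactor : ∀ i ∈ S, ∫⁻ s : ℝ, ENNReal.ofReal |Real.sinc (s * u i / 2)| ^ (1 / u i ^ 2) ≤
      ENNReal.ofReal (2 * Real.pi * √(1007 / 500)) := by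
    intro i hi
    have hi0 := hSne i hi
    have hsq : 0 < u i ^ 2 := by positivity
    have hscale := lintegral_comp_mul_right (hpow (1 / u i ^ 2))
      (a := u i / 2) (by positivity)
    simp only [← mul_div_assoc] at hscale
    rw [hscale]
    have h2 : 2 ≤ 1 / u i ^ 2 := by
      rw [le_div_iff₀ hsq]; linarith [hbig i]
    refine (mul_le_mul_right (sincMoment_le h2) _).trans (le_of_eq ?_)
    rw [← ENNReal.ofReal_mul (by positivity), div_div_eq_mul_div, div_one,
      Real.sqrt_mul (by norm_num), Real.sqrt_sq_eq_abs, abs_div, abs_of_pos (two_pos (α := ℝ))]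
    congr 1
    have := abs_pos.2 hi0
    field_simp
  have hprod : ∀ s : ℝ, ∏ i, ENNReal.ofReal |Real.sinc (s * u i / 2)| =
      ∏ i ∈ S, (ENNReal.ofReal |Real.sinc (s * u i / 2)| ^ (1 / u i ^ 2)) ^ (u i ^ 2) := by
    intro s
    rw [hS, Finset.prod_filter]
    refine Finset.prod_congr rfl fun i _ => ?_
    split_ifs with h
    · rw [← ENNReal.rpow_mul, one_div, inv_mul_cancel₀ (by positivity), ENNReal.rpow_one]
    · push Not at h
      simp [h]
  have hholder := ENNReal.lintegral_prod_norm_pow_le (μ := (volume : Measure ℝ)) S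
    (fun i _ => (hmeas i).aemeasurable) hsum (fun i _ => sq_nonneg (u i))
  refine (cubeGaussian_le_lintegral hv u).trans ?_
  simp_rw [hprod]
  have hle : ∏ i ∈ S, (∫⁻ s : ℝ, ENNReal.ofReal |Real.sinc (s * u i / 2)| ^ (1 / u i ^ 2)) ^ (u i ^ 2)
      ≤ ENNReal.ofReal (2 * Real.pi * √(1007 / 500)) := by
    calc _ ≤ ∏ i ∈ S, ENNReal.ofReal ((2 * Real.pi * √(1007 / 500)) ^ (u i ^ 2)) := by
          refine Finset.prod_le_prod' fun i hi => ?_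
          rw [← ENNReal.ofReal_rpow_of_pos hM]
          exact ENNReal.rpow_le_rpow (hfactor i hi) (sq_nonneg _)
      _ = _ := by
          rw [← ENNReal.ofReal_prod_of_nonneg (fun i _ => by positivity),
            ← Real.rpow_sum_of_pos hM, hsum, Real.rpow_one]
  refine (mul_le_mul_right (hholder.trans hle) _).trans (le_of_eq ?_)
  rw [← ENNReal.ofReal_mul (by positivity)]
  congr 1
  field_simp

lemma exists_linearIsometryEquiv_single_eq {m : ℕ} (u : E (m + 1)) (hu : ‖u‖ = 1) :
    ∃ T : E (m + 1) ≃ₗᵢ[ℝ] E (m + 1), T (EuclideanSpace.single 0 1) = u := by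
  have hon : Orthonormal ℝ (({0} : Set (Fin (m + 1))).domRestrict fun _ => u) :=
    ⟨fun _ => hu, fun i j hij => (hij (Subsingleton.elim i j)).elim⟩
  obtain ⟨b, hb⟩ := hon.exists_orthonormalBasis_extension_of_card_eq (by simp)
  refine ⟨b.repr.symm, ?_⟩
  rw [b.repr_symm_single, hb 0 rfl]

lemma exists_linearIsometry_hyperplane {m : ℕ} (u : E (m + 1)) (hu : ‖u‖ = 1) :
    ∃ ι : E m →ₗᵢ[ℝ] E (m + 1), Set.range ι = hyperplane u ∧
      MeasurePreserving (fun p : ℝ × E m => p.1 • u + ι p.2) := by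
  obtain ⟨T, hT⟩ := exists_linearIsometryEquiv_single_eq u hu
  let L : E m →ₗᵢ[ℝ] E (m + 1) :=
    { toFun := fun y => WithLp.toLp 2 (Fin.cons 0 y : Fin (m + 1) → ℝ)
      map_add' := fun x y => by
        ext i; refine Fin.cases ?_ (fun j => ?_) i <;> simp
      map_smul' := fun c y => by
        ext i; refine Fin.cases ?_ (fun j => ?_) i <;> simp
      norm_map' := fun y => by
        simp [EuclideanSpace.norm_eq, Fin.sum_univ_succ] }
  have hL : ∀ y, L y = WithLp.toLp 2 (Fin.cons 0 y : Fin (m + 1) → ℝ) := fun _ => rfl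
  refine ⟨T.toLinearIsometry.comp L, ?_, ?_⟩
  · ext x
    simp only [hyperplane, Set.mem_range, Set.mem_ofPred_eq]
    obtain ⟨z, rfl⟩ := T.surjective x
    rw [← hT, T.inner_map_map]
    simp only [LinearIsometry.coe_comp, Function.comp_apply, LinearIsometryEquiv.coe_toLinearIsometry,
      T.injective.eq_iff, EuclideanSpace.inner_single_right]
    constructor
    · rintro ⟨y, rfl⟩
      simp [hL]
    · intro hz
      refine ⟨WithLp.toLp 2 fun j => z j.succ, ?_⟩
      ext i
      refine Fin.cases ?_ (fun j => ?_) i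
      · simpa [hL] using hz.symm
      · simp [hL]
  · have h1 := (volume_preserving_piFinSuccAbove (fun _ : Fin (m + 1) => ℝ) 0).symm
    have h2 := (MeasurePreserving.id (volume : Measure ℝ)).prod
      (PiLp.volume_preserving_ofLp (Fin m))
    have h3 := T.measurePreserving.comp
      ((PiLp.volume_preserving_toLp (Fin (m + 1))).comp (h1.comp h2))
    have heq : (fun p : ℝ × E m => p.1 • u + T.toLinearIsometry.comp L p.2) =
        T ∘ WithLp.toLp 2 ∘ (MeasurableEquiv.piFinSuccAbove (fun _ : Fin (m + 1) => ℝ) 0).symm ∘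
          Prod.map id WithLp.ofLp := by
      ext1 ⟨t, y⟩
      have hsplit : WithLp.toLp 2 (Fin.cons t y : Fin (m + 1) → ℝ) =
          t • EuclideanSpace.single 0 1 + L y := by
        ext i
        refine Fin.cases ?_ (fun j => ?_) i <;> simp [hL]
      calc _ = T (t • EuclideanSpace.single 0 1 + L y) := by simp [hT]
        _ = T (WithLp.toLp 2 (Fin.cons t y : Fin (m + 1) → ℝ)) := by rw [hsplit]
        _ = _ := by
          simp only [Function.comp_apply, MeasurableEquiv.piFinSuccAbove]
          simp
          rfl
    rw [heq]
    exact h3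

lemma lintegral_gaussianPDF_Icc_ge {δ : ℝ} (hδ : 0 < δ) :
    ENNReal.ofReal (1 - δ) ≤
      ∫⁻ t in Set.Icc (-(δ / 2)) (δ / 2), ProbabilityTheory.gaussianPDF 0 (Real.toNNReal (δ ^ 3 / 4)) t := by
  set v := Real.toNNReal (δ ^ 3 / 4) with hv
  have hv0 : v ≠ 0 := by rw [hv, Ne, Real.toNNReal_eq_zero]; push Not; positivity
  have hcheb := ProbabilityTheory.meas_ge_le_variance_div_sq (μ := ProbabilityTheory.gaussianReal 0 v)
    (ProbabilityTheory.memLp_id_gaussianReal 2) (half_pos hδ)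
  rw [ProbabilityTheory.variance_id_gaussianReal, hv, Real.coe_toNNReal _ (by positivity)] at hcheb
  rw [← ProbabilityTheory.gaussianReal_apply _ hv0, ENNReal.ofReal_sub _ hδ.le, ENNReal.ofReal_one,
    tsub_le_iff_right, ← measure_univ (μ := ProbabilityTheory.gaussianReal 0 v)]
  refine (measure_mono fun t _ => ?_).trans ((measure_union_le _ _).trans
    (add_le_add le_rfl (hcheb.trans (ENNReal.ofReal_le_ofReal ?_))))
  · simp only [id, ProbabilityTheory.integral_id_gaussianReal, sub_zero, Set.mem_union, Set.mem_Icc,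
      Set.mem_ofPred_eq, ← abs_le]
    exact le_total _ _
  · rw [div_le_iff₀ (by positivity)]
    nlinarith

/-- Sections of the unit cube by hyperplanes through its center have volume at most `√2.014`. -/
lemma volume_cube_section_le {m : ℕ} (u : E (m + 1)) (hu : ‖u‖ = 1) (ι : E m →ₗᵢ[ℝ] E (m + 1))
    (hι : Set.range ι = hyperplane u)
    (hmp : MeasurePreserving (fun p : ℝ × E m => p.1 • u + ι p.2)) :
    volume {y : E m | ∀ i, |ι y i| ≤ 1 / 2} ≤ ENNReal.ofReal √(1007 / 500) := by
  set A := volume {y : E m | ∀ i, |ι y i| ≤ 1 / 2} with hA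
  have hui : ∀ i, |u i| ≤ 1 := fun i => hu ▸ PiLp.norm_apply_le u i
  have husq : ∑ i, u i ^ 2 = 1 := by
    rw [← EuclideanSpace.real_norm_sq_eq, hu, one_pow]
  have hbound : ∀ δ ∈ Set.Ioo (0 : ℝ) 1,
      ENNReal.ofReal ((1 - δ) ^ (m + 1)) * A ≤ ENNReal.ofReal √(1007 / 500) := by
    intro δ hδ
    obtain ⟨hδ0, hδ1⟩ := hδ
    have hδ' : 0 < 1 - δ := by linarith
    set v := Real.toNNReal (δ ^ 3 / 4) with hv
    have hv0 : v ≠ 0 := by rw [hv, Ne, Real.toNNReal_eq_zero]; push Not; positivity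
    refine le_trans ?_ (cubeGaussian_le hv0 (fun i => u i) husq)
    set C : Set (E (m + 1)) := {x | ∀ i, |x i| ≤ 1 / 2} with hC
    have hCm : MeasurableSet C := by
      rw [hC, Set.ofPred_forall]
      exact MeasurableSet.iInter fun i => measurableSet_le (by fun_prop) (by fun_prop)
    have hg := ProbabilityTheory.measurable_gaussianPDF 0 v
    have hcube : cubeGaussian v (fun i => u i) =
        ∫⁻ x in C, ProbabilityTheory.gaussianPDF 0 v ⟪x, u⟫ := by
      have hgs : Measurable fun x : Fin (m + 1) → ℝ =>
          ProbabilityTheory.gaussianPDF 0 v (∑ i, u i * x i) := hg.comp (by fun_prop)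
      rw [cubeGaussian, cubeMeasure, ← Measure.restrict_pi_pi, ← volume_pi,
        ← (PiLp.volume_preserving_ofLp (Fin (m + 1))).setLIntegral_comp_preimage
          (MeasurableSet.univ_pi fun _ => measurableSet_Icc) hgs]
      have hpre : WithLp.ofLp ⁻¹' (Set.univ.pi fun _ : Fin (m + 1) => Set.Icc (-(1 / 2) : ℝ) (1 / 2)) =
          C := by
        ext x
        simp only [hC, abs_le, Set.mem_preimage, Set.mem_univ_pi, Set.mem_Icc, Set.mem_ofPred_eq]
      rw [hpre]
      simp [PiLp.inner_apply]
    have hscale : volume {y : E m | ∀ i, |ι y i| ≤ (1 - δ) / 2} = ENNReal.ofReal ((1 - δ) ^ m) * A := by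
      have hpre : {y : E m | ∀ i, |ι y i| ≤ (1 - δ) / 2} =
          ((1 - δ)⁻¹ • ·) ⁻¹' {y : E m | ∀ i, |ι y i| ≤ 1 / 2} := by
        ext y
        simp only [Set.mem_ofPred_eq, Set.mem_preimage, map_smul, PiLp.smul_apply, smul_eq_mul,
          abs_mul, abs_inv, abs_of_pos hδ', inv_mul_le_iff₀ hδ', mul_one_div]
      rw [hpre, Measure.addHaar_preimage_smul _ (by positivity), finrank_euclideanSpace_fin,
        inv_pow, inv_inv, abs_of_pos (by positivity)]
    have hsub : Set.Icc (-(δ / 2)) (δ / 2) ×ˢ {y : E m | ∀ i, |ι y i| ≤ (1 - δ) / 2} ⊆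
        (fun p : ℝ × E m => p.1 • u + ι p.2) ⁻¹' C := by
      rintro ⟨t, y⟩ ⟨ht, hy⟩ i
      have h1 : |t * u i| ≤ δ / 2 := by
        rw [abs_mul]
        exact (mul_le_of_le_one_right (abs_nonneg _) (hui i)).trans (abs_le.2 ht)
      have h2 := hy i
      calc |t * u i + ι y i| ≤ |t * u i| + |ι y i| := abs_add_le _ _
        _ ≤ 1 / 2 := by linarith
    have hinner : ∀ p : ℝ × E m, ⟪p.1 • u + ι p.2, u⟫ = p.1 := by
      intro p
      have h0 : ι p.2 ∈ hyperplane u := hι ▸ Set.mem_range_self p.2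
      rw [hyperplane, Set.mem_ofPred_eq] at h0
      rw [inner_add_left, h0, real_inner_smul_left, real_inner_self_eq_norm_sq, hu]
      ring
    have hgu : Measurable fun x : E (m + 1) => ProbabilityTheory.gaussianPDF 0 v ⟪x, u⟫ :=
      hg.comp (by fun_prop)
    rw [hcube, ← hmp.setLIntegral_comp_preimage hCm hgu]
    simp_rw [hinner]
    refine le_trans ?_ (lintegral_mono_set hsub)
    rw [Measure.volume_eq_prod, ← Measure.prod_restrict,
      lintegral_prod (fun p : ℝ × E m => ProbabilityTheory.gaussianPDF 0 v p.1)
        (hg.comp measurable_fst).aemeasurable]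
    simp only [lintegral_const, Measure.restrict_apply_univ, hscale]
    rw [lintegral_mul_const _ hg, pow_succ', ENNReal.ofReal_mul hδ'.le, mul_assoc]
    exact mul_le_mul_left (lintegral_gaussianPDF_Icc_ge hδ0) _
  have hlim : Filter.Tendsto (fun δ : ℝ => ENNReal.ofReal ((1 - δ) ^ (m + 1)) * A)
      (nhdsWithin 0 (Set.Ioi 0)) (nhds (ENNReal.ofReal ((1 - 0) ^ (m + 1)) * A)) := by
    refine ENNReal.Tendsto.mul_const (ENNReal.tendsto_ofReal ?_) (Or.inl (by simp))
    exact ((by fun_prop : Continuous fun δ : ℝ => (1 - δ) ^ (m + 1)).tendsto 0).mono_left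
      nhdsWithin_le_nhds
  rw [sub_zero, one_pow, ENNReal.ofReal_one, one_mul] at hlim
  exact le_of_tendsto hlim (Filter.eventually_of_mem (Ioo_mem_nhdsGT one_pos) hbound)

lemma exists_hausdorffMeasure_eq_smul_volume (d : ℕ) :
    ∃ c : NNReal, c ≠ 0 ∧ (μH[(d : ℝ)] : Measure (E d)) = c • volume := by
  have h : Measure.IsAddHaarMeasure (μH[(d : ℝ)] : Measure (E d)) := by
    simpa using isAddHaarMeasure_hausdorffMeasure (E := E d)
  exact ⟨_, (Measure.addHaarScalarFactor_pos_of_isAddHaarMeasure _ _).ne',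
    Measure.isAddLeftInvariant_eq_smul _ _⟩

lemma volume_unit_cube (n : ℕ) : volume {x : E n | ∀ i, |x i| ≤ 1 / 2} = 1 := by
  have hpre : {x : E n | ∀ i, |x i| ≤ 1 / 2} =
      WithLp.ofLp ⁻¹' (Set.univ.pi fun _ : Fin n => Set.Icc (-(1 / 2) : ℝ) (1 / 2)) := by
    ext x
    simp only [abs_le, Set.mem_preimage, Set.mem_univ_pi, Set.mem_Icc, Set.mem_ofPred_eq]
  rw [hpre, (PiLp.volume_preserving_ofLp (Fin n)).measure_preimage
    (MeasurableSet.univ_pi fun _ => measurableSet_Icc).nullMeasurableSet, volume_pi_pi]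
  norm_num [Real.volume_Icc]

lemma hausdorffMeasure_inter_hyperplane {m : ℕ} {u : E (m + 1)} (ι : E m →ₗᵢ[ℝ] E (m + 1))
    (hι : Set.range ι = hyperplane u) (s : Set (E (m + 1))) :
    μH[(m : ℝ)] (s ∩ hyperplane u) = μH[(m : ℝ)] (ι ⁻¹' s) := by
  rw [← hι, ← Set.image_preimage_eq_inter_range,
    ι.isometry.hausdorffMeasure_image (Or.inl m.cast_nonneg)]

lemma hausdorffMeasure_cube_section_le {m : ℕ} {r : ℝ}
    (hr : ENNReal.ofReal √(1007 / 500) ≤ volume (closedBall (0 : E m) r))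
    {u : E (m + 1)} (hu : ‖u‖ = 1) :
    μH[(m : ℝ)] ({x : E (m + 1) | ∀ i, |x i| ≤ 1 / 2} ∩ hyperplane u) ≤
      μH[(m : ℝ)] (closedBall (0 : E (m + 1)) r ∩ hyperplane u) := by
  obtain ⟨ι, hι, hmp⟩ := exists_linearIsometry_hyperplane u hu
  obtain ⟨c, -, hc⟩ := exists_hausdorffMeasure_eq_smul_volume m
  have hball : ι ⁻¹' closedBall (0 : E (m + 1)) r = closedBall 0 r := by
    rw [← map_zero ι, ι.isometry.preimage_closedBall]
  rw [hausdorffMeasure_inter_hyperplane ι hι, hausdorffMeasure_inter_hyperplane ι hι, hball, hc,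
    Measure.smul_apply, Measure.smul_apply]
  exact smul_le_smul_of_nonneg_left ((volume_cube_section_le u hu ι hι hmp).trans hr) c.2

/-- The volume of the unit ball of `ℝⁿ`. -/
def unitBallVolume (n : ℕ) : ℝ := √Real.pi ^ n / Real.Gamma (n / 2 + 1)

lemma unitBallVolume_pos (n : ℕ) : 0 < unitBallVolume n :=
  div_pos (by positivity) (Real.Gamma_pos_of_pos (by positivity))

lemma unitBallVolume_add_two (n : ℕ) :
    unitBallVolume (n + 2) = 2 * Real.pi / (n + 2) * unitBallVolume n := by
  have h : ((n + 2 : ℕ) : ℝ) / 2 + 1 = (n / 2 + 1) + 1 := by push_cast; ring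
  have hG := Real.Gamma_pos_of_pos (show 0 < (n : ℝ) / 2 + 1 by positivity)
  rw [unitBallVolume, unitBallVolume, h, Real.Gamma_add_one (by positivity), pow_add,
    Real.sq_sqrt Real.pi_nonneg]
  field_simp

lemma unitBallVolume_log_concave (n : ℕ) :
    unitBallVolume n * unitBallVolume (n + 2) ≤ unitBallVolume (n + 1) ^ 2 := by
  have hx : 0 < (n : ℝ) / 2 + 1 := by positivity
  have h := Real.Gamma_mul_add_mul_le_rpow_Gamma_mul_rpow_Gamma hx
    (show 0 < ((n + 2 : ℕ) : ℝ) / 2 + 1 by positivity) (one_half_pos (α := ℝ)) one_half_pos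
    (by norm_num)
  have h1 : 1 / 2 * ((n : ℝ) / 2 + 1) + 1 / 2 * (((n + 2 : ℕ) : ℝ) / 2 + 1) =
      ((n + 1 : ℕ) : ℝ) / 2 + 1 := by push_cast; ring
  have hG0 := Real.Gamma_pos_of_pos hx
  have hG1 := Real.Gamma_pos_of_pos (show 0 < ((n + 1 : ℕ) : ℝ) / 2 + 1 by positivity)
  have hG2 := Real.Gamma_pos_of_pos (show 0 < ((n + 2 : ℕ) : ℝ) / 2 + 1 by positivity)
  rw [h1, ← Real.mul_rpow hG0.le hG2.le, ← Real.sqrt_eq_rpow, Real.le_sqrt' hG1] at h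
  rw [unitBallVolume, unitBallVolume, unitBallVolume, div_mul_div_comm, div_pow, ← pow_add, ← pow_mul]
  rw [show n + (n + 2) = (n + 1) * 2 by ring]
  gcongr

/-- The ratio of the volumes of consecutive unit balls. -/
def unitBallRatio (n : ℕ) : ℝ := unitBallVolume (n + 1) / unitBallVolume n

lemma unitBallRatio_pos (n : ℕ) : 0 < unitBallRatio n :=
  div_pos (unitBallVolume_pos _) (unitBallVolume_pos _)

lemma unitBallRatio_mul_succ (n : ℕ) :
    unitBallRatio n * unitBallRatio (n + 1) = 2 * Real.pi / (n + 2) := by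
  have h0 := unitBallVolume_pos n
  have h1 := unitBallVolume_pos (n + 1)
  rw [unitBallRatio, unitBallRatio, unitBallVolume_add_two]
  field_simp

lemma unitBallRatio_succ_le (n : ℕ) : unitBallRatio (n + 1) ≤ unitBallRatio n := by
  rw [unitBallRatio, unitBallRatio, div_le_div_iff₀ (unitBallVolume_pos _) (unitBallVolume_pos _)]
  linarith [unitBallVolume_log_concave n]

lemma unitBallRatio_add_two (n : ℕ) :
    unitBallRatio (n + 2) = (n + 2) / (n + 3) * unitBallRatio n := by
  have h1 := unitBallRatio_mul_succ n
  have h2 := unitBallRatio_mul_succ (n + 1)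
  have hp := unitBallRatio_pos (n + 1)
  push_cast at h2
  rw [← mul_left_inj' hp.ne', mul_assoc, h1, mul_comm, h2]
  have := Real.pi_pos
  field_simp
  ring

lemma unitBallRatio_sq_ge {n : ℕ} (hn : 4 ≤ n) :
    2 * Real.pi ≤ unitBallRatio n ^ 2 * (n + 77 / 50) := by
  have hanti : ∀ k : ℕ, unitBallRatio (n + 2 * k) ^ 2 * ((n + 2 * k : ℕ) + 77 / 50) ≤
      unitBallRatio n ^ 2 * (n + 77 / 50) := by
    intro k
    induction k with
    | zero => simp
    | succ k ih =>
      refine le_trans ?_ ih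
      rw [show n + 2 * (k + 1) = n + 2 * k + 2 by ring, unitBallRatio_add_two]
      have hm : (4 : ℝ) ≤ ((n + 2 * k : ℕ) : ℝ) := by exact_mod_cast (by omega : 4 ≤ n + 2 * k)
      generalize n + 2 * k = m at hm ⊢
      push_cast
      rw [mul_pow, mul_right_comm, mul_comm (unitBallRatio m ^ 2)]
      gcongr
      rw [div_pow, div_mul_eq_mul_div, div_le_iff₀ (by positivity)]
      nlinarith
  have hge : ∀ k : ℕ, 2 * Real.pi * (1 - 1 / ((k : ℝ) + 1)) ≤ unitBallRatio n ^ 2 * (n + 77 / 50) := by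
    intro k
    refine le_trans ?_ (hanti k)
    have hk : (k : ℝ) ≤ ((n + 2 * k : ℕ) : ℝ) := by exact_mod_cast (by omega)
    generalize n + 2 * k = m at hk ⊢
    have hq : 2 * Real.pi / (m + 2) ≤ unitBallRatio m ^ 2 := by
      rw [← unitBallRatio_mul_succ, sq]
      exact mul_le_mul_of_nonneg_left (unitBallRatio_succ_le m) (unitBallRatio_pos m).le
    calc _ ≤ 2 * Real.pi / (m + 2) * (m + 77 / 50) := by
          rw [div_mul_eq_mul_div, mul_div_assoc]
          gcongr
          rw [le_div_iff₀ (by positivity), one_sub_div (by positivity), div_mul_eq_mul_div,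
            div_le_iff₀ (by positivity)]
          nlinarith
      _ ≤ _ := by gcongr
  have hlim := (tendsto_one_div_add_atTop_nhds_zero_nat (𝕜 := ℝ)).const_sub 1 |>.const_mul
    (2 * Real.pi)
  rw [sub_zero, mul_one] at hlim
  exact le_of_tendsto' hlim hge

lemma sqrt_mul_unitBallRatio_pow_le {n : ℕ} (hn : 9 ≤ n) :
    √(1007 / 500) * unitBallRatio (n + 1) ^ (n + 1) ≤ unitBallRatio n ^ (n + 1) := by
  have hq := unitBallRatio_pos n
  have hq1 := unitBallRatio_pos (n + 1)
  have hn' : (9 : ℝ) ≤ n := by exact_mod_cast hn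
  have hratio : 1 + 23 / 50 / (n + 77 / 50) ≤ unitBallRatio n / unitBallRatio (n + 1) := by
    have h1 := unitBallRatio_mul_succ n
    have h2 := unitBallRatio_sq_ge (show 4 ≤ n by omega)
    have hq1' : unitBallRatio (n + 1) = 2 * Real.pi / (n + 2) / unitBallRatio n := by
      rw [eq_div_iff hq.ne', mul_comm, h1]
    have := Real.pi_pos
    rw [le_div_iff₀ hq1, hq1', ← mul_div_assoc, div_le_iff₀ hq, ← sq,
      show (1 + 23 / 50 / ((n : ℝ) + 77 / 50)) * (2 * Real.pi / (n + 2)) =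
        2 * Real.pi / (n + 77 / 50) by field_simp; ring, div_le_iff₀ (by positivity)]
    exact h2
  have hbern := one_add_mul_le_pow
    (show (-2 : ℝ) ≤ 23 / 50 / (n + 77 / 50) by linarith [show (0 : ℝ) ≤ 23 / 50 / (n + 77 / 50) by positivity]) (n + 1)
  rw [← le_div_iff₀ (by positivity), ← div_pow]
  refine le_trans ?_ (hbern.trans (pow_le_pow_left₀ (by positivity) hratio _))
  refine (Real.sqrt_le_sqrt (show (1007 / 500 : ℝ) ≤ (71 / 50) ^ 2 by norm_num)).trans ?_
  rw [Real.sqrt_sq (by norm_num), ← sub_le_iff_le_add', ← mul_div_assoc, le_div_iff₀ (by positivity)]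
  push_cast
  linarith

lemma unitBallVolume_zero : unitBallVolume 0 = 1 := by
  simp [unitBallVolume]

lemma unitBallVolume_one : unitBallVolume 1 = 2 := by
  have := Real.pi_pos
  rw [unitBallVolume, Nat.cast_one, Real.Gamma_add_one (by norm_num), Real.Gamma_one_half_eq]
  field_simp

lemma unitBallVolume_nine : unitBallVolume 9 = 32 * Real.pi ^ 4 / 945 := by
  rw [unitBallVolume_add_two 7, unitBallVolume_add_two 5, unitBallVolume_add_two 3,
    unitBallVolume_add_two 1, unitBallVolume_one]
  push_cast
  ring

lemma unitBallVolume_ten : unitBallVolume 10 = Real.pi ^ 5 / 120 := by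
  rw [unitBallVolume_add_two 8, unitBallVolume_add_two 6, unitBallVolume_add_two 4,
    unitBallVolume_add_two 2, unitBallVolume_add_two 0, unitBallVolume_zero]
  push_cast
  ring

lemma unitBallRatio_pow_mul_lt {n : ℕ} (hn : 9 ≤ n) :
    unitBallRatio n ^ n * √(1007 / 500) ^ (n + 1) < unitBallVolume n := by
  induction n, hn using Nat.le_induction with
  | base =>
    rw [unitBallRatio, unitBallVolume_nine, unitBallVolume_ten]
    have hs : √(1007 / 500 : ℝ) ^ 10 = (1007 / 500) ^ 5 := by
      rw [show 10 = 2 * 5 by rfl, pow_mul, Real.sq_sqrt (by norm_num)]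
    have hpi := Real.pi_pos
    have h5 : Real.pi ^ 5 ≤ 3.141593 ^ 5 := by
      gcongr
      exact Real.pi_lt_d6.le
    have hrat : Real.pi ^ 5 / 120 / (32 * Real.pi ^ 4 / 945) = 945 / 3840 * Real.pi := by
      field_simp
      norm_num
    rw [hrat, hs, mul_pow, show Real.pi ^ 9 = Real.pi ^ 5 * Real.pi ^ 4 by ring]
    have h4 : 0 < Real.pi ^ 4 := by positivity
    calc _ = (945 / 3840) ^ 9 * (1007 / 500) ^ 5 * Real.pi ^ 5 * Real.pi ^ 4 := by ring
      _ ≤ (945 / 3840) ^ 9 * (1007 / 500) ^ 5 * 3.141593 ^ 5 * Real.pi ^ 4 := by gcongr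
      _ < 32 / 945 * Real.pi ^ 4 := by
        gcongr
        norm_num
      _ = _ := by ring
  | succ n hn ih =>
    have hq := unitBallRatio_pos n
    calc _ = √(1007 / 500) * unitBallRatio (n + 1) ^ (n + 1) * √(1007 / 500) ^ (n + 1) := by ring
      _ ≤ unitBallRatio n ^ (n + 1) * √(1007 / 500) ^ (n + 1) := by
        gcongr
        exact sqrt_mul_unitBallRatio_pow_le hn
      _ = unitBallRatio n * (unitBallRatio n ^ n * √(1007 / 500) ^ (n + 1)) := by ring
      _ < unitBallRatio n * unitBallVolume n := by gcongr
      _ = _ := div_mul_cancel₀ _ (unitBallVolume_pos n).ne'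

lemma volume_closedBall_eq_unitBallVolume (n : ℕ) {r : ℝ} (hr : 0 ≤ r) :
    volume (closedBall (0 : E (n + 1)) r) = ENNReal.ofReal (r ^ (n + 1) * unitBallVolume (n + 1)) := by
  rw [EuclideanSpace.volume_closedBall, Fintype.card_fin, ENNReal.ofReal_mul (by positivity),
    ENNReal.ofReal_pow hr, unitBallVolume]

lemma exists_radius {n : ℕ} (hn : 9 ≤ n) :
    ∃ r : ℝ, 0 < r ∧ r ^ n * unitBallVolume n = √(1007 / 500) ∧
      r ^ (n + 1) * unitBallVolume (n + 1) < 1 := by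
  have hκ := unitBallVolume_pos n
  have hn0 : n ≠ 0 := by omega
  set c := √(1007 / 500) / unitBallVolume n with hc
  have hc0 : 0 < c := by positivity
  have hpow : (c ^ (1 / n : ℝ)) ^ n = c := by
    rw [one_div, Real.rpow_inv_natCast_pow hc0.le hn0]
  refine ⟨c ^ (1 / n : ℝ), by positivity, ?_, ?_⟩
  · rw [hpow, hc, div_mul_cancel₀ _ hκ.ne']
  · set r := c ^ (1 / n : ℝ) with hr
    have hr0 : 0 < r := by positivity
    refine lt_of_pow_lt_pow_left₀ n zero_le_one ?_
    have h := unitBallRatio_pow_mul_lt hn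
    have hκ1 : unitBallVolume (n + 1) = unitBallRatio n * unitBallVolume n :=
      (div_mul_cancel₀ _ hκ.ne').symm
    rw [one_pow, mul_pow, ← pow_mul, mul_comm (n + 1), pow_mul, hpow, hκ1, hc, div_pow]
    rw [mul_pow, div_mul_eq_mul_div, div_lt_one (by positivity), pow_succ (unitBallVolume n)]
    calc _ = unitBallRatio n ^ n * √(1007 / 500) ^ (n + 1) * unitBallVolume n ^ n := by ring
      _ < unitBallVolume n * unitBallVolume n ^ n := by gcongr
      _ = _ := mul_comm _ _

/-- (Ball.) For `n ≥ 10` the centered unit cube and a suitable centered ball give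
a negative answer to the Busemann–Petty problem. -/
theorem busemann_petty_negative_cube_ball (n : ℕ) (hn : 10 ≤ n) :
    ∃ r : ℝ, 0 < r ∧
      (∀ u ∈ sphere (0 : E n) 1,
        μH[(n : ℝ) - 1] ({x : E n | ∀ i, |x i| ≤ 1 / 2} ∩ hyperplane u)
          ≤ μH[(n : ℝ) - 1] (closedBall (0 : E n) r ∩ hyperplane u)) ∧
      μH[(n : ℝ)] (closedBall (0 : E n) r) < μH[(n : ℝ)] {x : E n | ∀ i, |x i| ≤ 1 / 2} := by
  obtain ⟨m, rfl⟩ : ∃ m, n = m + 1 := ⟨n - 1, by omega⟩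
  obtain ⟨r, hr, hsection, hvolume⟩ := exists_radius (show 9 ≤ m by omega)
  refine ⟨r, hr, fun u hu => ?_, ?_⟩
  · rw [Nat.cast_succ, add_sub_cancel_right]
    refine hausdorffMeasure_cube_section_le ?_ (mem_sphere_zero_iff_norm.1 hu)
    obtain ⟨k, rfl⟩ : ∃ k, m = k + 1 := ⟨m - 1, by omega⟩
    rw [volume_closedBall_eq_unitBallVolume k hr.le, hsection]
  · obtain ⟨c, hc, hμ⟩ := exists_hausdorffMeasure_eq_smul_volume (m + 1)
    rw [hμ, Measure.smul_apply, Measure.smul_apply, volume_unit_cube,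
      volume_closedBall_eq_unitBallVolume m hr.le]
    rw [ENNReal.smul_def, ENNReal.smul_def, smul_eq_mul, smul_eq_mul]
    refine ENNReal.mul_lt_mul_right (by simpa using hc) ENNReal.coe_ne_top ?_
    rwa [ENNReal.ofReal_lt_one]
end
end
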